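/- arXiv:1602.00476 — 7 statements merged into one kernel-verified Lean document; each statement's English description precedes it below -/
import Mathlib

section
/- For any two one-counter nets N and N' with control-state sets Q and Q', the maximal strong simulation relation ⪯, viewed as a subset of Q×ℕ×Q'×ℕ, is a semilinear set: for every pair (q,q') ∈ Q×Q', the set {(n,n') ∈ ℕ² : qn ⪯ q'n'} is a finite union of linear sets. -/
/-- A one-counter net over control states `Q` and actions `A`:
transitions carry a counter effect in `{-1, 0, 1}`. -/
structure OCN (Q A : Type) where
  δ : Q → A → ℤ → Q → Prop
  effect_bounded : ∀ p a d q, δ p a d q → d = -1 ∨ d = 0 ∨ d = 1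

namespace OCN

/-- The step relation of the LTS induced by a one-counter net on
configurations `Q × ℕ`:  `(p,m) →a (q,n)` iff there is a transition
`(p,a,d,q)` with `n = m + d ≥ 0`. -/
def Step {Q A : Type} (N : OCN Q A) (c : Q × ℕ) (a : A) (c' : Q × ℕ) : Prop :=
  ∃ d : ℤ, N.δ c.1 a d c'.1 ∧ (c'.2 : ℤ) = (c.2 : ℤ) + d

/-- An OCN is complete if every state has an `a`-labelled outgoing transition
for every action `a`. -/
def Complete {Q A : Type} (N : OCN Q A) : Prop :=
  ∀ p a, ∃ d q, N.δ p a d q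

/-- An OCN is non-blocking if every state has an outgoing transition with
counter effect in `{0, 1}`. -/
def NonBlocking {Q A : Type} (N : OCN Q A) : Prop :=
  ∀ p, ∃ a d q, N.δ p a d q ∧ (d = 0 ∨ d = 1)

end OCN

/-- `R` is a strong simulation between two labelled transition systems. -/
def IsSimulation {S S' A : Type} (stepL : S → A → S → Prop) (stepR : S' → A → S' → Prop)
    (R : S → S' → Prop) : Prop :=
  ∀ c c', R c c' → ∀ a d, stepL c a d → ∃ d', stepR c' a d' ∧ R d d'

/-- The strong simulation preorder `⪯`: the largest strong simulation,
i.e. the union of all strong simulations. -/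
def Simulates {S S' A : Type} (stepL : S → A → S → Prop) (stepR : S' → A → S' → Prop)
    (c : S) (c' : S') : Prop :=
  ∃ R, IsSimulation stepL stepR R ∧ R c c'

/-- A linear subset of `ℕ²`: a base `b` plus all `ℕ`-linear combinations of a
finite set of periods. -/
def IsLinearSubset (L : Set (ℕ × ℕ)) : Prop :=
  ∃ (b : ℕ × ℕ) (P : Finset (ℕ × ℕ)),
    L = {x | ∃ c : ℕ × ℕ → ℕ, x = b + ∑ p ∈ P, c p • p}

/-- A semilinear subset of `ℕ²`: a finite union of linear sets. -/
def IsSemilinearSubset (L : Set (ℕ × ℕ)) : Prop :=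
  ∃ (n : ℕ) (f : Fin n → Set (ℕ × ℕ)),
    (∀ i, IsLinearSubset (f i)) ∧ L = ⋃ i, f i


/-! ## Abstract counter games -/

/-- Abstract simulation game: a move of Spoiler from `k` is an effect together with the set
of available responses (effect, next state). -/
structure SimGame (K : Type) where
  mv : K → Set (ℤ × Set (ℤ × K))
  bd : ∀ k d O, (d, O) ∈ mv k → -1 ≤ d ∧ d ≤ 1
  bo : ∀ k d O, (d, O) ∈ mv k → ∀ d' k', (d', k') ∈ O → -1 ≤ d' ∧ d' ≤ 1

namespace SimGame

variable {K : Type} (G : SimGame K)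

def IsSim (R : K → ℤ → ℤ → Prop) : Prop :=
  ∀ k x z, R k x z → 0 ≤ x → 0 ≤ z ∧ ∀ d O, (d, O) ∈ G.mv k → 0 ≤ x + d →
    ∃ d' k', (d', k') ∈ O ∧ R k' (x + d) (z + d')

def Black (k : K) (x z : ℤ) : Prop := ∃ R, G.IsSim R ∧ R k x z

theorem black_isSim : G.IsSim G.Black := by
  rintro k x z ⟨R, hR, h⟩ hx
  obtain ⟨hz, h2⟩ := hR k x z h hx
  refine ⟨hz, fun d O hd hxd => ?_⟩
  obtain ⟨d', k', ho, h3⟩ := h2 d O hd hxd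
  exact ⟨d', k', ho, R, hR, h3⟩

/-- Coinduction up to `Black`. -/
theorem black_coind (R : K → ℤ → ℤ → Prop)
    (h : ∀ k x z, R k x z → 0 ≤ x → G.Black k x z ∨ (0 ≤ z ∧ ∀ d O, (d, O) ∈ G.mv k → 0 ≤ x + d →
      ∃ d' k', (d', k') ∈ O ∧ (R k' (x + d) (z + d') ∨ G.Black k' (x + d) (z + d'))))
    {k : K} {x z : ℤ} (hr : R k x z) : G.Black k x z := by
  refine ⟨fun k x z => R k x z ∨ G.Black k x z, ?_, Or.inl hr⟩
  have key : ∀ k x z, G.Black k x z → 0 ≤ x → 0 ≤ z ∧ ∀ d O, (d, O) ∈ G.mv k → 0 ≤ x + d →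
      ∃ d' k', (d', k') ∈ O ∧ (R k' (x + d) (z + d') ∨ G.Black k' (x + d) (z + d')) := by
    intro k x z hb hx
    obtain ⟨hz, h2⟩ := G.black_isSim k x z hb hx
    refine ⟨hz, fun d O hd hxd => ?_⟩
    obtain ⟨d', k', ho, h3⟩ := h2 d O hd hxd
    exact ⟨d', k', ho, Or.inr h3⟩
  rintro k x z (hr | hb) hx
  · rcases h k x z hr hx with hb | h2
    · exact key k x z hb hx
    · exact h2
  · exact key k x z hb hx

theorem black_mono {k : K} {x z x' z' : ℤ} (hb : G.Black k x z) (hx : x' ≤ x) (hz : z ≤ z') :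
    G.Black k x' z' := by
  refine G.black_coind (fun k x' z' => ∃ x z, x' ≤ x ∧ z ≤ z' ∧ G.Black k x z) ?_
    ⟨x, z, hx, hz, hb⟩
  rintro k x' z' ⟨x, z, hx, hz, hb⟩ h0
  right
  obtain ⟨hz0, h2⟩ := G.black_isSim k x z hb (by omega)
  refine ⟨by omega, fun d O hd hxd => ?_⟩
  obtain ⟨d', k', ho, h3⟩ := h2 d O hd (by omega)
  exact ⟨d', k', ho, Or.inl ⟨x + d, z + d', by omega, by omega, h3⟩⟩

/-- States whose frontier is finite everywhere. -/
def Fin : Set K := {k | ∀ x : ℤ, 0 ≤ x → ∃ z, G.Black k x z}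

/-- The frontier function. -/
noncomputable def fr (k : K) (x : ℤ) : ℤ := sInf {z : ℤ | G.Black k x z}

variable {G}

theorem black_nonneg {k : K} {x z : ℤ} (hx : 0 ≤ x) (h : G.Black k x z) : 0 ≤ z :=
  (G.black_isSim k x z h hx).1

theorem black_iff' {k : K} {x z : ℤ} (hx : 0 ≤ x) (hk : ∃ z, G.Black k x z) :
    G.Black k x z ↔ G.fr k x ≤ z := by
  have hbdd : BddBelow {z : ℤ | G.Black k x z} := ⟨0, fun z hz => black_nonneg hx hz⟩
  constructor
  · intro h
    exact csInf_le hbdd h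
  · intro h
    exact G.black_mono (Int.csInf_mem hk hbdd) le_rfl h

theorem black_iff {k : K} {x z : ℤ} (hk : k ∈ G.Fin) (hx : 0 ≤ x) :
    G.Black k x z ↔ G.fr k x ≤ z := black_iff' hx (hk x hx)

theorem fr_nonneg {k : K} {x : ℤ} (hk : k ∈ G.Fin) (hx : 0 ≤ x) : 0 ≤ G.fr k x :=
  black_nonneg hx ((black_iff hk hx).2 le_rfl)

theorem fr_mono {k : K} {x y : ℤ} (hk : k ∈ G.Fin) (hx : 0 ≤ x) (hxy : x ≤ y) :
    G.fr k x ≤ G.fr k y :=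
  (black_iff hk hx).1 (G.black_mono ((black_iff hk (hx.trans hxy)).2 le_rfl) hxy le_rfl)

/-- Duplicator has a response at a frontier point. -/
theorem fr_step {k : K} {x d : ℤ} {O : Set (ℤ × K)} (hk : k ∈ G.Fin) (hx : 0 ≤ x)
    (hd : (d, O) ∈ G.mv k) (hxd : 0 ≤ x + d) :
    ∃ d' k', (d', k') ∈ O ∧ G.Black k' (x + d) (G.fr k x + d') :=
  (G.black_isSim k x _ ((black_iff hk hx).2 le_rfl) hx).2 d O hd hxd

variable (G) in
theorem exists_threshold [Fintype K] : ∃ X : ℤ, 0 ≤ X ∧ ∀ k x z, X ≤ x → G.Black k x z → k ∈ G.Fin := by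
  classical
  have h : ∀ k : K, ∃ X : ℤ, 0 ≤ X ∧ ∀ x z, X ≤ x → G.Black k x z → k ∈ G.Fin := by
    intro k
    by_cases hk : k ∈ G.Fin
    · exact ⟨0, le_rfl, fun _ _ _ _ => hk⟩
    · have : ∃ x : ℤ, 0 ≤ x ∧ ∀ z, ¬ G.Black k x z := by
        simpa [Fin] using hk
      obtain ⟨X, hX, h⟩ := this
      exact ⟨X, hX, fun x z hx hb => absurd (G.black_mono hb hx le_rfl) (h z)⟩
  choose X hX h using h
  refine ⟨∑ k, X k, Finset.sum_nonneg fun k _ => hX k, fun k x z hx hb => h k x z ?_ hb⟩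
  exact (Finset.single_le_sum (fun k _ => hX k) (Finset.mem_univ k)).trans hx

/-- Upper shift lemma. -/
theorem shift_upper {X : ℤ} (hX0 : 0 ≤ X) (hX : ∀ k x z, X ≤ x → G.Black k x z → k ∈ G.Fin)
    (S : Set K) (hS : S ⊆ G.Fin) {n m b : ℤ} (hn : X ≤ n) (hm : 1 ≤ m) (hb : 0 ≤ b)
    (hbase : ∀ k ∈ S, G.fr k (n + m) ≤ G.fr k n + b)
    (hsep : ∀ k ∈ S, ∀ k' ∈ G.Fin, k' ∉ S → ∀ x d : ℤ, n < x → -1 ≤ d → d ≤ 1 →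
      G.fr k x + 1 < G.fr k' (x + d)) :
    ∀ k ∈ S, ∀ x, n ≤ x → G.fr k (x + m) ≤ G.fr k x + b := by
  intro k hk x hx
  rw [← black_iff (hS hk) (by omega)]
  refine G.black_coind (fun k y z => k ∈ S ∧ n + m ≤ y ∧ G.fr k (y - m) + b ≤ z) ?_
    ⟨hk, by omega, by rw [add_sub_cancel_right]⟩
  rintro k y z ⟨hk, hy, hz⟩ hy0
  have hkF := hS hk
  by_cases hyn : y = n + m
  · left
    rw [black_iff hkF hy0]
    have := hbase k hk
    subst hyn
    rw [add_sub_cancel_right] at hz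
    omega
  · right
    have h0 := fr_nonneg hkF (show 0 ≤ y - m by omega)
    refine ⟨by omega, fun d O hd hyd => ?_⟩
    have hd1 := G.bd k d O hd
    obtain ⟨d', k', ho, h3⟩ := fr_step hkF (show 0 ≤ y - m by omega) hd (by omega)
    have hd2 := G.bo k d O hd d' k' ho
    have hk'F := hX _ _ _ (by omega) h3
    rw [black_iff hk'F (by omega)] at h3
    refine ⟨d', k', ho, Or.inl ⟨?_, by omega, ?_⟩⟩
    · by_contra hk'
      have := hsep k hk k' hk'F hk' (y - m) d (by omega) hd1.1 hd1.2
      omega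
    · rw [show y + d - m = y - m + d by ring]
      omega

/-- Lower shift lemma. -/
theorem shift_lower {X : ℤ} (hX0 : 0 ≤ X) (hX : ∀ k x z, X ≤ x → G.Black k x z → k ∈ G.Fin)
    (S : Set K) (hS : S ⊆ G.Fin) {n m b : ℤ} (hn : X ≤ n) (hm : 1 ≤ m)
    (hbase : ∀ k ∈ S, G.fr k n + b ≤ G.fr k (n + m))
    (hsep : ∀ k ∈ S, ∀ k' ∈ G.Fin, k' ∉ S → ∀ x d : ℤ, n < x → -1 ≤ d → d ≤ 1 →
      G.fr k' (x + d) + 1 + b ≤ G.fr k (x + m)) :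
    ∀ k ∈ S, ∀ x, n ≤ x → G.fr k x + b ≤ G.fr k (x + m) := by
  intro k hk x hx
  suffices h : G.Black k x (G.fr k (x + m) - b) by
    rw [black_iff (hS hk) (by omega)] at h
    omega
  refine G.black_coind (fun k y z => k ∈ S ∧ n ≤ y ∧ G.fr k (y + m) - b ≤ z) ?_
    ⟨hk, by omega, le_rfl⟩
  rintro k y z ⟨hk, hy, hz⟩ hy0
  have hkF := hS hk
  have hbk := hbase k hk
  by_cases hyn : y = n
  · left
    rw [black_iff hkF hy0]
    subst hyn
    omega
  · right
    have h0 := fr_nonneg hkF (show 0 ≤ n by omega)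
    have h1 := fr_mono hkF (show 0 ≤ n + m by omega) (show n + m ≤ y + m by omega)
    refine ⟨by omega, fun d O hd hyd => ?_⟩
    have hd1 := G.bd k d O hd
    obtain ⟨d', k', ho, h3⟩ := fr_step hkF (show 0 ≤ y + m by omega) hd (by omega)
    have hd2 := G.bo k d O hd d' k' ho
    have hk'F := hX _ _ _ (by omega) h3
    rw [black_iff hk'F (by omega)] at h3
    refine ⟨d', k', ho, ?_⟩
    by_cases hk' : k' ∈ S
    · left
      refine ⟨hk', by omega, ?_⟩
      rw [show y + d + m = y + m + d by ring]
      omega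
    · right
      rw [black_iff hk'F hyd]
      have := hsep k hk k' hk'F hk' y d (by omega) hd1.1 hd1.2
      omega

theorem fr_linear_bound [Fintype K] : ∃ R C : ℝ, 0 ≤ R ∧ ∀ k ∈ G.Fin, ∀ x : ℤ, 0 ≤ x →
    (G.fr k x : ℝ) ≤ R * x + C := by
  classical
  obtain ⟨X, hX0, hX⟩ := G.exists_threshold
  set b : ℤ := ∑ k, |G.fr k (X + 1) - G.fr k X| with hb
  have hbk : ∀ k, |G.fr k (X + 1) - G.fr k X| ≤ b := fun k =>
    Finset.single_le_sum (f := fun k => |G.fr k (X + 1) - G.fr k X|)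
      (fun k _ => abs_nonneg _) (Finset.mem_univ k)
  have hb0 : 0 ≤ b := Finset.sum_nonneg fun k _ => abs_nonneg _
  have h1 := shift_upper hX0 hX G.Fin subset_rfl (n := X) (m := 1) (b := b) le_rfl le_rfl hb0
    (fun k _ => by have := (abs_le.1 (hbk k)).2; omega)
    (fun k _ k' hk' hk'' => absurd hk' hk'')
  have h2 : ∀ k ∈ G.Fin, ∀ t : ℕ, G.fr k (X + t) ≤ G.fr k X + b * t := by
    intro k hk t
    induction t with
    | zero => simp
    | succ t ih =>
      have := h1 k hk (X + t) (by omega)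
      push_cast
      rw [← add_assoc]
      linarith
  refine ⟨b, ∑ k, |(G.fr k X : ℝ)|, by exact_mod_cast hb0, fun k hk x hx => ?_⟩
  have h3 : (G.fr k X : ℝ) ≤ ∑ k, |(G.fr k X : ℝ)| :=
    (le_abs_self _).trans (Finset.single_le_sum (f := fun k => |(G.fr k X : ℝ)|)
      (fun k _ => abs_nonneg _) (Finset.mem_univ k))
  have h4 := h2 k hk x.toNat
  have h5 := fr_mono hk hx (show x ≤ X + (x.toNat : ℤ) by omega)
  have h6 : G.fr k x ≤ G.fr k X + b * x := by
    rw [Int.toNat_of_nonneg hx] at h4 h5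
    omega
  have h7 : (G.fr k x : ℝ) ≤ G.fr k X + b * x := by exact_mod_cast h6
  linarith

/-! ## The potential lemma -/

/-- Duplicator potentials on `W` (with error `ε`). -/
def DupPot (G : SimGame K) (L W : Set K) (β B ε : ℝ) (y : K → ℝ) : Prop :=
  (∀ k, 0 ≤ y k ∧ y k ≤ B) ∧ ∀ w ∈ W, ∀ d O, (d, O) ∈ G.mv w → ∃ d' k', (d', k') ∈ O ∧
    (k' ∈ L ∨ (k' ∈ W ∧ y k' + β * d - d' ≤ y w + ε))

/-- Spoiler potentials on `V` with gain `ε`. -/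
def SpoPot (G : SimGame K) (V : Set K) (β B ε : ℝ) (y : K → ℝ) : Prop :=
  (∀ k, 0 ≤ y k ∧ y k ≤ B) ∧ ∀ v ∈ V, ∃ d O, (d, O) ∈ G.mv v ∧ ∀ d' k', (d', k') ∈ O →
    (k' ∉ G.Fin ∨ (k' ∈ V ∧ y v + ε ≤ y k' + β * d - d'))

open Classical in
/-- Extension of a valuation by extreme values on settled states. -/
noncomputable def extv (G : SimGame K) (L : Set K) (D B : ℝ) (y : K → ℝ) (k : K) : ℝ :=
  if k ∈ L then -D else if k ∈ G.Fin then y k else B + D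

theorem extv_mono (G : SimGame K) (L : Set K) (D B : ℝ) {y y' : K → ℝ} (h : ∀ k, y k ≤ y' k)
    (k : K) : G.extv L D B y k ≤ G.extv L D B y' k := by
  unfold extv
  split_ifs
  · exact le_rfl
  · exact h k
  · exact le_rfl

theorem exists_fix (G : SimGame K) (L : Set K) (β D B ε : ℝ) (hB : 0 ≤ B) (hε : 0 < ε) :
    ∃ y : K → ℝ, (∀ k, 0 ≤ y k ∧ y k ≤ B) ∧
      (∀ k, 0 < y k → ∃ d O, (d, O) ∈ G.mv k ∧ ∀ d' k', (d', k') ∈ O →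
        y k + ε / 2 ≤ G.extv L D B y k' + β * d - d') ∧
      (∀ k, y k + ε ≤ B → ∀ d O, (d, O) ∈ G.mv k → ∃ d' k', (d', k') ∈ O ∧
        G.extv L D B y k' + β * d - d' < y k + 2 * ε) := by
  have : Fact ((0 : ℝ) ≤ B) := ⟨hB⟩
  let Sset : (K → Set.Icc (0 : ℝ) B) → K → Set (Set.Icc (0 : ℝ) B) := fun y k =>
    {c | ∃ d O, (d, O) ∈ G.mv k ∧ ∀ d' k', (d', k') ∈ O →
      (c : ℝ) + ε ≤ G.extv L D B (fun k => (y k : ℝ)) k' + β * d - d'}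
  let Φ : (K → Set.Icc (0 : ℝ) B) →o (K → Set.Icc (0 : ℝ) B) :=
    ⟨fun y k => sSup (Sset y k), by
      intro y y' hyy k
      apply sSup_le_sSup
      rintro c ⟨d, O, hd, h⟩
      refine ⟨d, O, hd, fun d' k' ho => (h d' k' ho).trans ?_⟩
      have := extv_mono G L D B (y := fun k => (y k : ℝ)) (y' := fun k => (y' k : ℝ))
        (fun k => hyy k) k'
      linarith⟩
  let y := Φ.lfp
  have hy : ∀ k, sSup (Sset y k) = y k := fun k => congrFun Φ.map_lfp k
  refine ⟨fun k => (y k : ℝ), fun k => (y k).2, fun k hk => ?_, fun k hk d O hd => ?_⟩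
  · by_cases hlt : (y k : ℝ) - ε / 2 < 0
    · have hne : (Sset y k).Nonempty := by
        rw [Set.nonempty_iff_ne_empty]
        intro he
        have := hy k
        rw [he, sSup_empty] at this
        have hk2 : (0 : ℝ) < (y k : ℝ) := hk
        rw [← this] at hk2
        exact lt_irrefl _ hk2
      obtain ⟨c, d, O, hd, h⟩ := hne
      refine ⟨d, O, hd, fun d' k' ho => le_trans ?_ (h d' k' ho)⟩
      have := c.2.1
      linarith
    · have hc : (⟨(y k : ℝ) - ε / 2, by linarith, by linarith [(y k).2.2]⟩ : Set.Icc (0 : ℝ) B)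
          < sSup (Sset y k) := by
        rw [hy k, ← Subtype.coe_lt_coe]
        simp only
        linarith
      obtain ⟨c, ⟨d, O, hd, h⟩, hlt⟩ := lt_sSup_iff.1 hc
      refine ⟨d, O, hd, fun d' k' ho => le_trans ?_ (h d' k' ho)⟩
      rw [← Subtype.coe_lt_coe] at hlt
      simp only at hlt
      linarith
  · by_contra hcon
    push Not at hcon
    have hc : (⟨(y k : ℝ) + ε, by linarith [(y k).2.1], hk⟩ : Set.Icc (0 : ℝ) B) ∈ Sset y k := by
      refine ⟨d, O, hd, fun d' k' ho => ?_⟩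
      have := hcon d' k' ho
      simp only
      linarith
    have := le_sSup hc
    rw [hy k, ← Subtype.coe_le_coe] at this
    simp only at this
    linarith

/-- A gap exists among few values. -/
theorem exists_gap [Fintype K] (y : K → ℝ) (D : ℝ) (hD : 0 < D) :
    ∃ j : ℕ, j ≤ Fintype.card K ∧ ∀ k, y k < j * D ∨ (j + 1) * D ≤ y k := by
  by_contra hcon
  push Not at hcon
  have h : ∀ j : _root_.Fin (Fintype.card K + 1), ∃ k, (j : ℕ) * D ≤ y k ∧ y k < ((j : ℕ) + 1) * D :=
    fun j => hcon j (by omega)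
  choose g hg using h
  have hinj : Function.Injective g := by
    intro i j hij
    have hi := hg i
    have hj := hg j
    rw [hij] at hi
    have h1 : ((i : ℕ) : ℝ) < (j : ℕ) + 1 := lt_of_mul_lt_mul_right (hi.1.trans_lt hj.2) hD.le
    have h2 : ((j : ℕ) : ℝ) < (i : ℕ) + 1 := lt_of_mul_lt_mul_right (hj.1.trans_lt hi.2) hD.le
    have h3 : (i : ℕ) < j + 1 := by exact_mod_cast h1
    have h4 : (j : ℕ) < i + 1 := by exact_mod_cast h2
    ext
    omega
  have := Fintype.card_le_of_injective g hinj
  simp at this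

theorem exists_pot_eps [Fintype K] (G : SimGame K) (L : Set K) (hL : L ⊆ G.Fin) (β ε : ℝ)
    (hβ : 0 ≤ β) (hε : 0 < ε) (hε1 : ε ≤ 1 / 2) :
    ∃ W : Set K, W ⊆ G.Fin \ L ∧ ∃ y,
      G.DupPot L W β ((Fintype.card K + 1) * (β + 3)) (2 * ε) y ∧
      G.SpoPot ((G.Fin \ L) \ W) β ((Fintype.card K + 1) * (β + 3)) (ε / 2) y := by
  set D : ℝ := β + 3 with hD
  set B : ℝ := (Fintype.card K + 1) * D with hB
  have hDpos : 0 < D := by linarith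
  have hB0 : 0 ≤ B := by positivity
  obtain ⟨y, hy, hy1, hy2⟩ := exists_fix G L β D B ε hB0 hε
  obtain ⟨j, hj, hgap⟩ := exists_gap y D hDpos
  have hjB : (j + 1 : ℝ) * D ≤ B := by
    have : (j : ℝ) ≤ Fintype.card K := by exact_mod_cast hj
    rw [hB]
    gcongr
  have hj0 : 0 ≤ (j : ℝ) * D := by positivity
  have hbd : ∀ d d' : ℤ, (-1 ≤ d ∧ d ≤ 1) → (-1 ≤ d' ∧ d' ≤ 1) →
      β * d - d' ≤ β + 1 ∧ -(β + 1) ≤ β * d - d' := by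
    intro d d' hd hd'
    have h1 : (-1 : ℝ) ≤ d := by exact_mod_cast hd.1
    have h2 : (d : ℝ) ≤ 1 := by exact_mod_cast hd.2
    have h3 : (-1 : ℝ) ≤ d' := by exact_mod_cast hd'.1
    have h4 : (d' : ℝ) ≤ 1 := by exact_mod_cast hd'.2
    constructor <;> nlinarith
  refine ⟨{k | k ∈ G.Fin \ L ∧ y k < j * D}, fun k hk => hk.1, y, ⟨hy, ?_⟩, ⟨hy, ?_⟩⟩
  · rintro w ⟨hwU, hw⟩ d O hd
    obtain ⟨d', k', ho, h⟩ := hy2 w (by nlinarith) d O hd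
    have hb := hbd d d' (G.bd w d O hd) (G.bo w d O hd d' k' ho)
    refine ⟨d', k', ho, ?_⟩
    by_cases hkL : k' ∈ L
    · exact Or.inl hkL
    · right
      by_cases hkF : k' ∈ G.Fin
      · have he : G.extv L D B y k' = y k' := by simp [extv, hkL, hkF]
        rw [he] at h
        refine ⟨⟨⟨hkF, hkL⟩, ?_⟩, h.le⟩
        rcases hgap k' with h1 | h1
        · exact h1
        · exfalso
          nlinarith
      · exfalso
        have he : G.extv L D B y k' = B + D := by simp [extv, hkL, hkF]
        rw [he] at h
        nlinarith
  · rintro v ⟨hvU, hv⟩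
    have hv' : (j + 1) * D ≤ y v := by
      rcases hgap v with h1 | h1
      · exact absurd ⟨hvU, h1⟩ hv
      · exact h1
    obtain ⟨d, O, hd, h⟩ := hy1 v (by nlinarith)
    refine ⟨d, O, hd, fun d' k' ho => ?_⟩
    have hb := hbd d d' (G.bd v d O hd) (G.bo v d O hd d' k' ho)
    have h1 := h d' k' ho
    by_cases hkL : k' ∈ L
    · exfalso
      have he : G.extv L D B y k' = -D := by simp [extv, hkL]
      rw [he] at h1
      nlinarith
    · by_cases hkF : k' ∈ G.Fin
      · right
        have he : G.extv L D B y k' = y k' := by simp [extv, hkL, hkF]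
        rw [he] at h1
        refine ⟨⟨⟨hkF, hkL⟩, ?_⟩, h1⟩
        rintro ⟨-, h2⟩
        nlinarith
      · exact Or.inl hkF

theorem SpoPot.finiteOpt {G : SimGame K} [Fintype K] {k : K} {d : ℤ} {O : Set (ℤ × K)}
    (hd : (d, O) ∈ G.mv k) : O.Finite := by
  refine ((Set.finite_Icc (-1 : ℤ) 1).prod (Set.toFinite (Set.univ : Set K))).subset ?_
  rintro ⟨d', k'⟩ ho
  exact ⟨G.bo k d O hd d' k' ho, trivial⟩

/-- The limit of Duplicator potentials. -/
theorem dupPot_limit [Fintype K] (G : SimGame K) (L W : Set K) (β B : ℝ)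
    (h : ∀ ε > 0, ∃ y, G.DupPot L W β B ε y) : ∃ y, G.DupPot L W β B 0 y := by
  have h' : ∀ n : ℕ, ∃ y, G.DupPot L W β B (1 / ((n : ℝ) + 1)) y := fun n => h _ (by positivity)
  choose y hy using h'
  have hcomp : IsCompact (Set.Icc (fun _ : K => (0 : ℝ)) (fun _ => B)) := isCompact_Icc
  obtain ⟨z, hz, φ, hφ, hlim⟩ := hcomp.tendsto_subseq (x := y)
    (fun n => ⟨fun k => ((hy n).1 k).1, fun k => ((hy n).1 k).2⟩)
  have hlimk : ∀ k, Filter.Tendsto (fun n => y (φ n) k) Filter.atTop (nhds (z k)) := fun k =>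
    (tendsto_pi_nhds.1 hlim) k
  have hε : Filter.Tendsto (fun n => 1 / ((φ n : ℝ) + 1)) Filter.atTop (nhds 0) :=
    tendsto_one_div_add_atTop_nhds_zero_nat.comp hφ.tendsto_atTop
  refine ⟨z, fun k => ⟨hz.1 k, hz.2 k⟩, fun w hw d O hd => ?_⟩
  by_contra hcon
  push Not at hcon
  have hfin : O.Finite := SpoPot.finiteOpt hd
  have hev : ∀ᶠ n in Filter.atTop, ∀ p ∈ O, p.2 ∉ L ∧
      (p.2 ∈ W → y (φ n) w + 1 / ((φ n : ℝ) + 1) < y (φ n) p.2 + β * d - p.1) := by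
    rw [Filter.eventually_all_finite hfin]
    rintro ⟨d', k'⟩ ho
    have h1 := hcon d' k' ho
    by_cases hk' : k' ∈ W
    · have h2 := h1.2 hk'
      have ht1 : Filter.Tendsto (fun n => y (φ n) w + 1 / ((φ n : ℝ) + 1)) Filter.atTop
          (nhds (z w + 0)) := (hlimk w).add hε
      have ht2 : Filter.Tendsto (fun n => y (φ n) k' + β * d - d') Filter.atTop
          (nhds (z k' + β * d - d')) := ((hlimk k').add_const _).sub_const _
      filter_upwards [ht1.eventually_lt ht2 h2] with n hn
      exact ⟨h1.1, fun _ => hn⟩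
    · exact Filter.Eventually.of_forall fun n => ⟨h1.1, fun h => absurd h hk'⟩
  obtain ⟨n, hn⟩ := hev.exists
  obtain ⟨d', k', ho, h3⟩ := (hy (φ n)).2 w hw d O hd
  have h4 := hn _ ho
  rcases h3 with h3 | ⟨h3, h5⟩
  · exact h4.1 h3
  · exact absurd (h4.2 h3) (not_lt.2 h5)

/-- The potential lemma. -/
theorem exists_pot [Fintype K] (G : SimGame K) (L : Set K) (hL : L ⊆ G.Fin) (β : ℝ) (hβ : 0 ≤ β) :
    ∃ W : Set K, W ⊆ G.Fin \ L ∧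
      (∃ y, G.DupPot L W β ((Fintype.card K + 1) * (β + 3)) 0 y) ∧
      ∃ ε > 0, ∃ y, G.SpoPot ((G.Fin \ L) \ W) β ((Fintype.card K + 1) * (β + 3)) ε y := by
  have h := fun n : ℕ => exists_pot_eps G L hL β (1 / ((n : ℝ) + 1) / 2) hβ (by positivity) (by
    have : 1 / ((n : ℝ) + 1) ≤ 1 := by
      rw [div_le_one (by positivity)]
      linarith [(Nat.cast_nonneg n : (0 : ℝ) ≤ n)]
    linarith)
  choose W hW y hy1 hy2 using h
  obtain ⟨W0, hW0⟩ := Finite.exists_infinite_fiber W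
  have hinf : (W ⁻¹' {W0}).Infinite := Set.infinite_coe_iff.1 hW0
  obtain ⟨n0, hn0⟩ := hinf.nonempty
  have hn0 : W n0 = W0 := hn0
  refine ⟨W0, hn0 ▸ hW n0, dupPot_limit G L W0 β _ fun ε hε => ?_,
    1 / ((n0 : ℝ) + 1) / 2 / 2, ?_, y n0, ?_⟩
  · obtain ⟨N, hN⟩ := exists_nat_one_div_lt hε
    obtain ⟨n, hn, hNn⟩ := hinf.exists_gt N
    have hn : W n = W0 := hn
    refine ⟨y n, (hy1 n).1, fun w hw d O hd => ?_⟩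
    rw [← hn] at hw ⊢
    obtain ⟨d', k', ho, h3⟩ := (hy1 n).2 w hw d O hd
    refine ⟨d', k', ho, h3.imp id fun h4 => ⟨h4.1, h4.2.trans ?_⟩⟩
    have : 1 / ((n : ℝ) + 1) ≤ 1 / ((N : ℝ) + 1) := by
      have : (N : ℝ) ≤ n := by exact_mod_cast hNn.le
      gcongr
    linarith
  · positivity
  · rw [← hn0]
    exact hy2 n0

/-- Duplicator potentials give upper bounds. -/
theorem DupPot.upper {G : SimGame K} {L W : Set K} {β B : ℝ} {y : K → ℝ}
    (h : G.DupPot L W β B 0 y) (hL : L ⊆ G.Fin) (hW : W ⊆ G.Fin) {β₀ C : ℝ} (hβ₀ : 0 ≤ β₀)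
    (hβ : β₀ ≤ β) (hC : 0 ≤ C)
    (hLb : ∀ l ∈ L, ∀ x : ℤ, 0 ≤ x → (G.fr l x : ℝ) ≤ β₀ * x + C) :
    ∃ C' : ℝ, ∀ w ∈ W, ∀ x : ℤ, 0 ≤ x → (G.fr w x : ℝ) ≤ β * x + C' := by
  refine ⟨B + (β₀ + C + 1) + 1, fun w hw x hx => ?_⟩
  have hb : G.Black w x ⌈β * x + y w + (β₀ + C + 1)⌉ := by
    refine G.black_coind
      (fun w x z => w ∈ W ∧ 0 ≤ x ∧ β * x + y w + (β₀ + C + 1) ≤ (z : ℝ)) ?_ ⟨hw, hx, Int.le_ceil _⟩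
    rintro w x z ⟨hw, hx, hz⟩ -
    right
    have hy0 := (h.1 w).1
    have hxR : (0 : ℝ) ≤ x := by exact_mod_cast hx
    have hβx : 0 ≤ β * x := mul_nonneg (hβ₀.trans hβ) hxR
    have hβx' : β₀ * x ≤ β * x := mul_le_mul_of_nonneg_right hβ hxR
    refine ⟨?_, fun d O hd hxd => ?_⟩
    · have : (0 : ℝ) ≤ z := by linarith
      exact_mod_cast this
    · obtain ⟨d', k', ho, h3⟩ := h.2 w hw d O hd
      refine ⟨d', k', ho, ?_⟩
      have h1 : (-1 : ℝ) ≤ d' := by exact_mod_cast (G.bo w d O hd d' k' ho).1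
      have h2 : (d : ℝ) ≤ 1 := by exact_mod_cast (G.bd w d O hd).2
      rcases h3 with h3 | ⟨h3, h4⟩
      · right
        rw [black_iff (hL h3) hxd]
        have h5 := hLb k' h3 (x + d) hxd
        push_cast at h5
        have : (G.fr k' (x + d) : ℝ) ≤ ((z + d' : ℤ) : ℝ) := by
          push_cast
          nlinarith
        exact_mod_cast this
      · left
        refine ⟨h3, hxd, ?_⟩
        push_cast
        linarith
  rw [black_iff (hW hw) hx] at hb
  have h1 : (G.fr w x : ℝ) ≤ ⌈β * x + y w + (β₀ + C + 1)⌉ := by exact_mod_cast hb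
  have h2 := Int.ceil_lt_add_one (β * x + y w + (β₀ + C + 1))
  have := (h.1 w).2
  linarith

/-- Spoiler potentials give lower bounds. -/
theorem SpoPot.lower {G : SimGame K} {V : Set K} {β B ε : ℝ} {y : K → ℝ}
    (h : G.SpoPot V β B ε y) (hV : V ⊆ G.Fin) (hβ : 0 ≤ β) (hε : 0 < ε) {X : ℤ} (hX0 : 0 ≤ X)
    (hX : ∀ k x z, X ≤ x → G.Black k x z → k ∈ G.Fin) {C : ℝ}
    (hlow : ∀ v ∈ V, ∀ x : ℤ, 0 ≤ x → (β - ε / 2) * x - C ≤ (G.fr v x : ℝ)) :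
    ∀ v ∈ V, ∀ x : ℤ, 0 ≤ x → β * x - (β * X + B) ≤ (G.fr v x : ℝ) := by
  intro v hv x hx
  by_contra hcon
  push Not at hcon
  set e : K → ℤ → ℝ := fun v x => β * x + y v - G.fr v x with he
  have he0 : β * X + B < e v x := by
    have := (h.1 v).1
    simp only [he]
    linarith
  have chain : ∀ t : ℕ, ∃ v' ∈ V, ∃ x' : ℤ, 0 ≤ x' ∧ x' ≤ x + t ∧ e v x + ε * t ≤ e v' x' := by
    intro t
    induction t with
    | zero => exact ⟨v, hv, x, hx, by simp, by simp⟩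
    | succ t ih =>
      obtain ⟨v', hv', x', hx', hxt, het⟩ := ih
      have hXx : X < x' := by
        by_contra hle
        push Not at hle
        have h1 : (x' : ℝ) ≤ X := by exact_mod_cast hle
        have h2 := (h.1 v').2
        have h3 : (0 : ℝ) ≤ G.fr v' x' := by exact_mod_cast fr_nonneg (hV hv') hx'
        have h4 : 0 ≤ ε * t := by positivity
        have h5 : β * x' ≤ β * X := mul_le_mul_of_nonneg_left h1 hβ
        simp only [he] at het he0
        linarith
      obtain ⟨d, O, hd, hO⟩ := h.2 v' hv'
      have hd1 := G.bd v' d O hd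
      obtain ⟨d', k', ho, hb⟩ := fr_step (hV hv') hx' hd (by omega)
      have hk' := hX _ _ _ (by omega) hb
      rw [black_iff hk' (by omega)] at hb
      rcases hO d' k' ho with h1 | ⟨h1, h2⟩
      · exact absurd hk' h1
      · refine ⟨k', h1, x' + d, by omega, by push_cast; omega, ?_⟩
        have hb' : (G.fr k' (x' + d) : ℝ) ≤ G.fr v' x' + d' := by exact_mod_cast hb
        simp only [he] at het ⊢
        push_cast
        linarith
  obtain ⟨t, ht⟩ := exists_nat_gt ((ε / 2 * x + C + B - e v x) / (ε / 2))
  obtain ⟨v', hv', x', hx', hxt, het⟩ := chain t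
  have h1 := hlow v' hv' x' hx'
  have h2 := (h.1 v').2
  have h3 : (x' : ℝ) ≤ x + t := by exact_mod_cast hxt
  rw [div_lt_iff₀ (by positivity)] at ht
  have h4 : ε / 2 * x' ≤ ε / 2 * (x + t) := by gcongr
  have h5 : e v' x' ≤ ε / 2 * x' + C + B := by
    simp only [he]
    linarith
  linarith

/-! ## The belt theorem -/

theorem slope_le {a b c c' : ℝ} (h : ∀ x : ℤ, 0 ≤ x → a * x - c ≤ b * x + c') : a ≤ b := by
  by_contra hlt
  push Not at hlt
  obtain ⟨t, ht⟩ := exists_nat_gt ((c + c') / (a - b))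
  rw [div_lt_iff₀ (by linarith)] at ht
  have := h t (by positivity)
  push_cast at this
  nlinarith

theorem SpoPot.tilt {G : SimGame K} {V : Set K} {β B ε : ℝ} {y : K → ℝ}
    (h : G.SpoPot V β B ε y) (hε : 0 < ε) : G.SpoPot V (β + ε / 4) B (3 * ε / 4) y := by
  refine ⟨h.1, fun v hv => ?_⟩
  obtain ⟨d, O, hd, hO⟩ := h.2 v hv
  refine ⟨d, O, hd, fun d' k' ho => (hO d' k' ho).imp id fun h1 => ⟨h1.1, ?_⟩⟩
  have h2 : (-1 : ℝ) ≤ d := by exact_mod_cast (G.bd v d O hd).1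
  nlinarith [h1.2]

theorem belt_step [Fintype K] (G : SimGame K) (L : Set K) (hL : L ⊆ G.Fin)
    (hne : (G.Fin \ L).Nonempty) {β₀ C : ℝ} (hβ₀ : 0 ≤ β₀) (hC : 0 ≤ C)
    (h1 : ∀ l ∈ L, ∀ x : ℤ, 0 ≤ x → (G.fr l x : ℝ) ≤ β₀ * x + C)
    (h2 : ∀ u ∈ G.Fin \ L, ∀ x : ℤ, 0 ≤ x → β₀ * x - C ≤ (G.fr u x : ℝ)) :
    ∃ β C' : ℝ, β₀ ≤ β ∧ 0 ≤ C' ∧ ∃ W ⊆ G.Fin \ L, W.Nonempty ∧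
      (∀ w ∈ W, ∀ x : ℤ, 0 ≤ x → (G.fr w x : ℝ) ≤ β * x + C') ∧
      (∀ u ∈ G.Fin \ L, ∀ x : ℤ, 0 ≤ x → β * x - C' ≤ (G.fr u x : ℝ)) := by
  obtain ⟨X, hX0, hX⟩ := G.exists_threshold
  obtain ⟨R, CR, hR, hRC⟩ := fr_linear_bound (G := G)
  obtain ⟨u0, hu0⟩ := hne
  set S : Set ℝ := {b | ∃ C : ℝ, ∀ u ∈ G.Fin \ L, ∀ x : ℤ, 0 ≤ x → b * x - C ≤ (G.fr u x : ℝ)}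
    with hS
  have hbdd : BddAbove S := by
    refine ⟨R, ?_⟩
    rintro b ⟨Cb, hb⟩
    exact slope_le fun x hx => (hb u0 hu0 x hx).trans (hRC u0 hu0.1 x hx)
  have hβ₀S : β₀ ∈ S := ⟨C, h2⟩
  set β := sSup S with hβ
  have hββ₀ : β₀ ≤ β := le_csSup hbdd hβ₀S
  have hβ0 : 0 ≤ β := hβ₀.trans hββ₀
  have hbelow : ∀ b < β, b ∈ S := by
    intro b hb
    obtain ⟨s, ⟨Cs, hs⟩, hbs⟩ := exists_lt_of_lt_csSup ⟨β₀, hβ₀S⟩ hb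
    refine ⟨Cs, fun u hu x hx => le_trans ?_ (hs u hu x hx)⟩
    have : (0 : ℝ) ≤ x := by exact_mod_cast hx
    nlinarith
  obtain ⟨W, hW, ⟨y, hy⟩, ε, hε, z, hz⟩ := exists_pot G L hL β hβ0
  obtain ⟨C1, hC1⟩ := hy.upper hL (fun w hw => (hW hw).1) hβ₀ hββ₀ hC h1
  have hWne : W.Nonempty := by
    by_contra hWe
    rw [Set.not_nonempty_iff_eq_empty] at hWe
    subst hWe
    rw [Set.sdiff_empty] at hz
    obtain ⟨C2, hC2⟩ := hbelow (β - ε / 8) (by linarith)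
    have h3 := (hz.tilt hε).lower (fun v hv => hv.1) (by linarith) (by linarith) hX0 hX
      (C := C2) (fun v hv x hx => by
        have := hC2 v hv x hx
        have h4 : β + ε / 4 - 3 * ε / 4 / 2 = β - ε / 8 := by ring
        rw [h4]
        exact this)
    have h5 : β + ε / 4 ∈ S := ⟨_, h3⟩
    have := le_csSup hbdd h5
    linarith
  have hlow : β ∈ S := by
    rcases hββ₀.eq_or_lt with heq | hlt
    · rw [← heq]
      exact hβ₀S
    · refine ⟨β * X + (Fintype.card K + 1) * (β + 3), fun u hu x hx => ?_⟩
      have hxR : (0 : ℝ) ≤ x := by exact_mod_cast hx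
      have hXR : (0 : ℝ) ≤ X := by exact_mod_cast hX0
      have hb : ∀ b, β₀ ≤ b → b < β →
          b * x - (β * X + (Fintype.card K + 1) * (β + 3)) ≤ (G.fr u x : ℝ) := by
        intro b hb1 hb2
        have hb0 : 0 ≤ b := hβ₀.trans hb1
        obtain ⟨W', hW', ⟨y', hy'⟩, ε', hε', z', hz'⟩ := exists_pot G L hL b hb0
        obtain ⟨C3, hC3⟩ := hy'.upper hL (fun w hw => (hW' hw).1) hβ₀ hb1 hC h1
        have hWe : W' = ∅ := by
          by_contra hWe
          obtain ⟨w, hw⟩ := Set.nonempty_iff_ne_empty.2 hWe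
          obtain ⟨C4, hC4⟩ := hbelow ((b + β) / 2) (by linarith)
          have : (b + β) / 2 ≤ b :=
            slope_le fun x hx => (hC4 w (hW' hw) x hx).trans (hC3 w hw x hx)
          linarith
        subst hWe
        rw [Set.sdiff_empty] at hz'
        obtain ⟨C2, hC2⟩ := hbelow (b - ε' / 2) (by linarith)
        have h3 := hz'.lower (fun v hv => hv.1) hb0 hε' hX0 hX hC2 u hu x hx
        have h4 : b * X ≤ β * X := mul_le_mul_of_nonneg_right hb2.le hXR
        have h5 : ((Fintype.card K : ℝ) + 1) * (b + 3) ≤ (Fintype.card K + 1) * (β + 3) := by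
          gcongr
        linarith
      by_contra hcon
      push Not at hcon
      set M := β * X + (Fintype.card K + 1) * (β + 3)
      set g := β * x - M - G.fr u x with hg
      have hg0 : 0 < g := by linarith
      have hq : 0 < g / (x + 1) := by positivity
      have h6 := hb (max β₀ (β - g / (x + 1))) (le_max_left _ _) (max_lt hlt (by linarith))
      have h7 : (β - g / (x + 1)) * x ≤ max β₀ (β - g / (x + 1)) * x :=
        mul_le_mul_of_nonneg_right (le_max_right _ _) hxR
      have h8 : g / (x + 1) * (x + 1) = g := by field_simp
      nlinarith
  obtain ⟨C2, hC2⟩ := hlow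
  refine ⟨β, max 0 (max C1 C2), hββ₀, le_max_left _ _, W, hW, hWne, fun w hw x hx => ?_,
    fun u hu x hx => ?_⟩
  · have := hC1 w hw x hx
    have h3 : C1 ≤ max 0 (max C1 C2) := (le_max_left _ _).trans (le_max_right _ _)
    linarith
  · have := hC2 u hu x hx
    have h3 : C2 ≤ max 0 (max C1 C2) := (le_max_right _ _).trans (le_max_right _ _)
    linarith

theorem belt_aux [Fintype K] (G : SimGame K) (n : ℕ) : ∀ L : Set K, L ⊆ G.Fin →
    (G.Fin \ L).ncard ≤ n → ∀ β₀ C : ℝ, 0 ≤ β₀ → 0 ≤ C →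
    (∀ l ∈ L, ∀ x : ℤ, 0 ≤ x → (G.fr l x : ℝ) ≤ β₀ * x + C) →
    (∀ u ∈ G.Fin \ L, ∀ x : ℤ, 0 ≤ x → β₀ * x - C ≤ (G.fr u x : ℝ)) →
    ∀ u ∈ G.Fin \ L, ∃ χ C' : ℝ, 0 ≤ χ ∧ ∀ x : ℤ, 0 ≤ x → |(G.fr u x : ℝ) - χ * x| ≤ C' := by
  induction n with
  | zero =>
    intro L hL hn β₀ C _ _ _ _ u hu
    have : G.Fin \ L = ∅ := (Set.ncard_eq_zero (Set.toFinite _)).1 (by omega)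
    rw [this] at hu
    exact absurd hu (Set.notMem_empty u)
  | succ n ih =>
    intro L hL hn β₀ C hβ₀ hC h1 h2 u hu
    obtain ⟨β, C', hβ, hC', W, hW, hWne, hW1, hW2⟩ := belt_step G L hL ⟨u, hu⟩ hβ₀ hC h1 h2
    by_cases huW : u ∈ W
    · refine ⟨β, C', hβ₀.trans hβ, fun x hx => ?_⟩
      have := hW1 u huW x hx
      have := hW2 u hu x hx
      rw [abs_le]
      constructor <;> linarith
    · have hd : G.Fin \ (L ∪ W) = (G.Fin \ L) \ W := Set.sdiff_sdiff.symm
      refine ih (L ∪ W) (Set.union_subset hL fun w hw => (hW hw).1) ?_ β (C + C')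
        (hβ₀.trans hβ) (by linarith) ?_ ?_ u ?_
      · rw [hd]
        have : ((G.Fin \ L) \ W).ncard < (G.Fin \ L).ncard := by
          apply Set.ncard_lt_ncard _ (Set.toFinite _)
          refine ⟨Set.sdiff_subset, fun h => ?_⟩
          obtain ⟨w, hw⟩ := hWne
          exact (h (hW hw)).2 hw
        omega
      · rintro l (hl | hl) x hx
        · have := h1 l hl x hx
          have hxR : (0 : ℝ) ≤ x := by exact_mod_cast hx
          nlinarith
        · have := hW1 l hl x hx
          linarith
      · intro v hv x hx
        rw [hd] at hv
        have := hW2 v hv.1 x hx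
        linarith
      · rw [hd]
        exact ⟨hu, huW⟩

/-- The belt theorem. -/
theorem belt [Fintype K] (G : SimGame K) : ∃ (χ : K → ℝ) (C : ℝ), 0 ≤ C ∧ (∀ k, 0 ≤ χ k) ∧
    ∀ k ∈ G.Fin, ∀ x : ℤ, 0 ≤ x → |(G.fr k x : ℝ) - χ k * x| ≤ C := by
  have h : ∀ k : K, ∃ χ C : ℝ, 0 ≤ χ ∧ 0 ≤ C ∧
      (k ∈ G.Fin → ∀ x : ℤ, 0 ≤ x → |(G.fr k x : ℝ) - χ * x| ≤ C) := by
    intro k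
    by_cases hk : k ∈ G.Fin
    · obtain ⟨χ, C, hχ, h⟩ := belt_aux G _ ∅ (Set.empty_subset _) le_rfl 0 0 le_rfl le_rfl
        (fun l hl => absurd hl (Set.notMem_empty l))
        (fun u hu x hx => by
          have : (0 : ℝ) ≤ G.fr u x := by exact_mod_cast fr_nonneg hu.1 hx
          linarith) k ⟨hk, Set.notMem_empty k⟩
      exact ⟨χ, C, hχ, (abs_nonneg _).trans (h 0 le_rfl), fun _ => h⟩
    · exact ⟨0, 0, le_rfl, le_rfl, fun h => absurd h hk⟩
  choose χ C hχ hC h using h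
  refine ⟨χ, ∑ k, C k, Finset.sum_nonneg fun k _ => hC k, hχ, fun k hk x hx => ?_⟩
  exact (h k hk x hx).trans (Finset.single_le_sum (fun k _ => hC k) (Finset.mem_univ k))

/-! ## Ultimate periodicity of the frontier -/

theorem exists_sep [Fintype K] (χ : K → ℝ) (c : ℝ) : ∃ δ > 0, ∀ k, (χ k < c → χ k + δ ≤ c) ∧
    (c < χ k → c + δ ≤ χ k) := by
  classical
  set F : Finset ℝ := insert 1 ((Finset.univ.image fun k => |χ k - c|).filter (0 < ·)) with hF
  have hne : F.Nonempty := ⟨1, Finset.mem_insert_self _ _⟩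
  have hmem := F.min'_mem hne
  refine ⟨F.min' hne, ?_, fun k => ?_⟩
  · rcases Finset.mem_insert.1 hmem with h | h
    · rw [h]
      exact one_pos
    · exact (Finset.mem_filter.1 h).2
  · have key : χ k ≠ c → F.min' hne ≤ |χ k - c| := by
      intro h
      apply Finset.min'_le
      rw [hF]
      refine Finset.mem_insert_of_mem (Finset.mem_filter.2
        ⟨Finset.mem_image_of_mem _ (Finset.mem_univ k), ?_⟩)
      exact abs_pos.2 (sub_ne_zero.2 h)
    constructor
    · intro h
      have := key h.ne
      rw [abs_of_neg (by linarith)] at this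
      linarith
    · intro h
      have := key h.ne'
      rw [abs_of_pos (by linarith)] at this
      linarith

theorem periodic [Fintype K] (G : SimGame K) {k0 : K} (hk0 : k0 ∈ G.Fin) :
    ∃ n m b : ℤ, 0 ≤ n ∧ 1 ≤ m ∧ 0 ≤ b ∧ ∀ x, n ≤ x → G.fr k0 (x + m) = G.fr k0 x + b := by
  classical
  obtain ⟨X, hX0, hX⟩ := G.exists_threshold
  obtain ⟨χ, C, hC, hχ, hbelt⟩ := belt G
  obtain ⟨δ, hδ, hsep⟩ := exists_sep χ (χ k0)
  set c := χ k0 with hc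
  have hc0 : 0 ≤ c := hχ k0
  have up : ∀ k ∈ G.Fin, ∀ x : ℤ, 0 ≤ x → (G.fr k x : ℝ) ≤ χ k * x + C := fun k hk x hx => by
    have := (abs_le.1 (hbelt k hk x hx)).2
    linarith
  have lo : ∀ k ∈ G.Fin, ∀ x : ℤ, 0 ≤ x → χ k * x - C ≤ (G.fr k x : ℝ) := fun k hk x hx => by
    have := (abs_le.1 (hbelt k hk x hx)).1
    linarith
  obtain ⟨p, hp⟩ := exists_nat_gt ((4 * C + 2 + c + δ) / δ)
  rw [div_lt_iff₀ hδ] at hp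
  set M : ℤ := ⌈2 * C⌉ with hM
  -- pigeonhole
  have hbound : ∀ k, k ∈ G.Fin ∧ χ k = c → ∀ x : ℤ, 0 ≤ x →
      G.fr k x - G.fr k0 x ∈ Set.Icc (-M) M := by
    rintro k ⟨hk, hkc⟩ x hx
    have h1 := up k hk x hx
    have h2 := lo k hk x hx
    have h3 := up k0 hk0 x hx
    have h4 := lo k0 hk0 x hx
    have h5 : 2 * C ≤ M := Int.le_ceil _
    rw [hkc] at h1 h2
    rw [← hc] at h3 h4
    constructor
    · have : (-M : ℝ) ≤ G.fr k x - G.fr k0 x := by linarith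
      exact_mod_cast this
    · have : (G.fr k x : ℝ) - G.fr k0 x ≤ M := by linarith
      exact_mod_cast this
  have hM0 : 0 ≤ M := Int.ceil_nonneg (by linarith)
  let pos : ℕ → ℤ := fun t => X + p + t * (p + 1)
  have hpos : ∀ t, X + p ≤ pos t := fun t => by
    have : (0 : ℤ) ≤ t * (p + 1) := by positivity
    simp only [pos]
    linarith
  let f : ℕ → K → Set.Icc (-M) M := fun t k =>
    if h : k ∈ G.Fin ∧ χ k = c then
      ⟨G.fr k (pos t) - G.fr k0 (pos t), hbound k h _ (by have := hpos t; omega)⟩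
    else ⟨0, by omega, hM0⟩
  obtain ⟨s, t, hst, hf⟩ : ∃ s t, s < t ∧ f s = f t := by
    obtain ⟨s, t, hne, hf⟩ := Finite.exists_ne_map_eq_of_infinite f
    rcases lt_or_gt_of_ne hne with h | h
    · exact ⟨s, t, h, hf⟩
    · exact ⟨t, s, h, hf.symm⟩
  set n := pos s with hn
  set m := pos t - pos s with hm
  have hnm : n + m = pos t := by omega
  have hnp : X + p ≤ n := hpos s
  have hmp : (p : ℤ) + 1 ≤ m := by
    have h1 : m = ((t : ℤ) - s) * (p + 1) := by
      simp only [hm, pos]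
      ring
    rw [h1]
    have h2 : (1 : ℤ) ≤ (t : ℤ) - s := by omega
    nlinarith
  have hn0 : 0 ≤ n := by omega
  set b := G.fr k0 (n + m) - G.fr k0 n with hb
  have hb0 : 0 ≤ b := by
    have := fr_mono hk0 hn0 (y := n + m) (by omega)
    omega
  have hclass : ∀ k ∈ G.Fin, χ k = c → G.fr k (n + m) = G.fr k n + b := by
    intro k hk hkc
    have h0 := congrArg Subtype.val (congrFun hf k)
    have hkk : k ∈ G.Fin ∧ χ k = c := ⟨hk, hkc⟩
    have h1 : G.fr k n - G.fr k0 n = G.fr k (pos t) - G.fr k0 (pos t) := by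
      simpa only [f, dif_pos hkk] using h0
    rw [← hnm] at h1
    omega
  have hpR : (p : ℝ) ≤ m := by exact_mod_cast (by omega : (p : ℤ) ≤ m)
  have hnR : (p : ℝ) ≤ n := by exact_mod_cast (by omega : (p : ℤ) ≤ n)
  have hmδ : 4 * C ≤ δ * m := by nlinarith
  have hb1 : c * m - 2 * C ≤ b := by
    have h1 := up k0 hk0 n hn0
    have h2 := lo k0 hk0 (n + m) (by omega)
    rw [hb]
    push_cast at h2 ⊢
    rw [← hc] at h1 h2
    linarith
  have hb2 : b ≤ c * m + 2 * C := by
    have h1 := lo k0 hk0 n hn0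
    have h2 := up k0 hk0 (n + m) (by omega)
    rw [hb]
    push_cast at h2 ⊢
    rw [← hc] at h1 h2
    linarith
  have hm0 : (0 : ℝ) ≤ m := by exact_mod_cast (by omega : (0 : ℤ) ≤ m)
  have hlowb : ∀ k ∈ G.Fin, χ k < c → G.fr k (n + m) ≤ G.fr k n + b := by
    intro k hk hkc
    have h1 := lo k hk n hn0
    have h2 := up k hk (n + m) (by omega)
    have h3 := (hsep k).1 hkc
    have h4 : (G.fr k (n + m) : ℝ) ≤ G.fr k n + b := by
      push_cast at h2
      nlinarith
    exact_mod_cast h4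
  have hhighb : ∀ k ∈ G.Fin, c < χ k → G.fr k n + b ≤ G.fr k (n + m) := by
    intro k hk hkc
    have h1 := up k hk n hn0
    have h2 := lo k hk (n + m) (by omega)
    have h3 := (hsep k).2 hkc
    have h4 : (G.fr k n : ℝ) + b ≤ G.fr k (n + m) := by
      push_cast at h2
      nlinarith
    exact_mod_cast h4
  have hxδ : ∀ x : ℤ, n < x → 4 * C + 2 + c + δ ≤ δ * x ∧ (1 : ℝ) ≤ x := by
    intro x hx
    have h1 : (p : ℝ) ≤ x := by exact_mod_cast (by omega : (p : ℤ) ≤ x)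
    refine ⟨by nlinarith, ?_⟩
    exact_mod_cast (by omega : (1 : ℤ) ≤ x)
  have hU := shift_upper hX0 hX {k | k ∈ G.Fin ∧ χ k ≤ c} (fun k hk => hk.1) (n := n) (m := m)
    (b := b) (by omega) (by omega) hb0
    (by
      rintro k ⟨hk, hkc⟩
      rcases hkc.eq_or_lt with h | h
      · exact (hclass k hk h).le
      · exact hlowb k hk h)
    (by
      rintro k ⟨hk, hkc⟩ k' hk' hk'' x d hx hd1 hd2
      have hlt : c < χ k' := by
        by_contra h
        exact hk'' ⟨hk', not_lt.1 h⟩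
      have h3 := (hsep k').2 hlt
      obtain ⟨h4, h5⟩ := hxδ x hx
      have h1 := up k hk x (by omega)
      have h2 := lo k' hk' (x + d) (by omega)
      have hdR : (-1 : ℝ) ≤ d := by exact_mod_cast hd1
      have h6 : (c + δ) * (x - 1) ≤ χ k' * ((x + d : ℤ) : ℝ) := by
        push_cast
        apply mul_le_mul h3 (by linarith) (by linarith) (hχ k')
      have h7 : χ k * x ≤ c * x := mul_le_mul_of_nonneg_right hkc (by linarith)
      have h8 : (G.fr k x : ℝ) + 1 < G.fr k' (x + d) := by nlinarith
      exact_mod_cast h8)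
  have hL := shift_lower hX0 hX {k | k ∈ G.Fin ∧ c ≤ χ k} (fun k hk => hk.1) (n := n) (m := m)
    (b := b) (by omega) (by omega)
    (by
      rintro k ⟨hk, hkc⟩
      rcases hkc.eq_or_lt with h | h
      · exact (hclass k hk h.symm).ge
      · exact hhighb k hk h)
    (by
      rintro k ⟨hk, hkc⟩ k' hk' hk'' x d hx hd1 hd2
      have hlt : χ k' < c := by
        by_contra h
        exact hk'' ⟨hk', not_lt.1 h⟩
      have h3 := (hsep k').1 hlt
      obtain ⟨h4, h5⟩ := hxδ x hx
      have h1 := up k' hk' (x + d) (by omega)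
      have h2 := lo k hk (x + m) (by omega)
      have hdR : (d : ℝ) ≤ 1 := by exact_mod_cast hd2
      have hdR' : (-1 : ℝ) ≤ d := by exact_mod_cast hd1
      have h6 : χ k' * ((x + d : ℤ) : ℝ) ≤ (c - δ) * (x + 1) := by
        push_cast
        apply mul_le_mul (by linarith) (by linarith) (by linarith)
        linarith [hχ k']
      have h7 : c * ((x + m : ℤ) : ℝ) ≤ χ k * ((x + m : ℤ) : ℝ) := by
        apply mul_le_mul_of_nonneg_right hkc
        push_cast
        linarith
      have h8 : (G.fr k' (x + d) : ℝ) + 1 + b ≤ G.fr k (x + m) := by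
        have h9 : c * ((x + m : ℤ) : ℝ) = c * x + c * m := by push_cast; ring
        nlinarith
      exact_mod_cast h8)
  refine ⟨n, m, b, hn0, by omega, hb0, fun x hx => le_antisymm ?_ ?_⟩
  · exact hU k0 ⟨hk0, le_rfl⟩ x hx
  · exact hL k0 ⟨hk0, le_rfl⟩ x hx

end SimGame

/-! ## Semilinear sets -/

theorem IsLinearSubset.semilinear {L : Set (ℕ × ℕ)} (h : IsLinearSubset L) :
    IsSemilinearSubset L :=
  ⟨1, fun _ => L, fun _ => h, by
    ext x
    simp only [Set.mem_iUnion]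
    exact ⟨fun hx => ⟨0, hx⟩, fun ⟨_, hx⟩ => hx⟩⟩

theorem semilinear_empty : IsSemilinearSubset ∅ :=
  ⟨0, fun _ => ∅, fun i => i.elim0, by simp⟩

theorem IsSemilinearSubset.union {A B : Set (ℕ × ℕ)} (hA : IsSemilinearSubset A)
    (hB : IsSemilinearSubset B) : IsSemilinearSubset (A ∪ B) := by
  obtain ⟨n, f, hf, rfl⟩ := hA
  obtain ⟨m, g, hg, rfl⟩ := hB
  refine ⟨n + m, Fin.append f g, fun i => ?_, ?_⟩
  · refine Fin.addCases (fun i => ?_) (fun i => ?_) i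
    · rw [Fin.append_left]
      exact hf i
    · rw [Fin.append_right]
      exact hg i
  · ext x
    simp only [Set.mem_union, Set.mem_iUnion]
    constructor
    · rintro (⟨i, hi⟩ | ⟨i, hi⟩)
      · exact ⟨Fin.castAdd m i, by rwa [Fin.append_left]⟩
      · exact ⟨Fin.natAdd n i, by rwa [Fin.append_right]⟩
    · rintro ⟨i, hi⟩
      revert hi
      refine Fin.addCases (fun i hi => ?_) (fun i hi => ?_) i
      · rw [Fin.append_left] at hi
        exact Or.inl ⟨i, hi⟩
      · rw [Fin.append_right] at hi
        exact Or.inr ⟨i, hi⟩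

theorem semilinear_biUnion (n : ℕ) (f : ℕ → Set (ℕ × ℕ)) (h : ∀ i < n, IsSemilinearSubset (f i)) :
    IsSemilinearSubset {x | ∃ i < n, x ∈ f i} := by
  induction n with
  | zero =>
    convert semilinear_empty using 1
    ext x
    simp
  | succ n ih =>
    convert (ih fun i hi => h i (by omega)).union (h n (by omega)) using 1
    ext x
    simp only [Set.mem_ofPred_eq, Set.mem_union]
    constructor
    · rintro ⟨i, hi, hx⟩
      rcases Nat.lt_succ_iff_lt_or_eq.1 hi with h1 | h1
      · exact Or.inl ⟨i, h1, hx⟩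
      · exact Or.inr (h1 ▸ hx)
    · rintro (⟨i, hi, hx⟩ | hx)
      · exact ⟨i, by omega, hx⟩
      · exact ⟨n, by omega, hx⟩

/-- A vertical ray is linear. -/
theorem linear_ray (x0 z0 : ℕ) : IsLinearSubset {x : ℕ × ℕ | x.1 = x0 ∧ z0 ≤ x.2} := by
  refine ⟨(x0, z0), {(0, 1)}, ?_⟩
  ext ⟨x, z⟩
  simp only [Set.mem_ofPred_eq, Finset.sum_singleton, Prod.ext_iff, Prod.fst_add, Prod.snd_add,
    Prod.smul_fst, Prod.smul_snd, smul_eq_mul, mul_zero, mul_one, add_zero]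
  constructor
  · rintro ⟨h1, h2⟩
    exact ⟨fun _ => z - z0, h1, by simp only; omega⟩
  · rintro ⟨c, h1, h2⟩
    exact ⟨h1, by omega⟩

/-- A periodic family of rays is linear. -/
theorem linear_cone (x0 z0 m b : ℕ) (hm : 1 ≤ m) :
    IsLinearSubset {x : ℕ × ℕ | ∃ i : ℕ, x.1 = x0 + i * m ∧ z0 + i * b ≤ x.2} := by
  refine ⟨(x0, z0), {(m, b), (0, 1)}, ?_⟩
  have hne : ((m, b) : ℕ × ℕ) ≠ (0, 1) := by
    intro h
    have := congrArg Prod.fst h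
    simp only at this
    omega
  ext ⟨x, z⟩
  simp only [Set.mem_ofPred_eq, Finset.sum_pair hne, Prod.ext_iff, Prod.fst_add, Prod.snd_add,
    Prod.smul_fst, Prod.smul_snd, smul_eq_mul, mul_zero, mul_one, add_zero]
  constructor
  · rintro ⟨i, h1, h2⟩
    refine ⟨fun p => if p = (m, b) then i else z - (z0 + i * b), ?_, ?_⟩
    · simpa using h1
    · simp only [if_true, if_neg hne.symm]
      omega
  · rintro ⟨c, h1, h2⟩
    exact ⟨c (m, b), h1, by omega⟩

/-- Each column of a frontier set which is upward closed is semilinear. -/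
theorem semilinear_column (x0 : ℕ) (P : ℕ → Prop) (hP : ∀ z z', P z → z ≤ z' → P z') :
    IsSemilinearSubset {x : ℕ × ℕ | x.1 = x0 ∧ P x.2} := by
  classical
  by_cases h : ∃ z, P z
  · convert (linear_ray x0 (Nat.find h)).semilinear using 1
    ext ⟨x, z⟩
    simp only [Set.mem_ofPred_eq]
    refine and_congr_right fun _ => ⟨fun hz => Nat.find_min' h hz, fun hz => ?_⟩
    exact hP _ _ (Nat.find_spec h) hz
  · convert semilinear_empty using 1
    ext ⟨x, z⟩
    simp only [Set.mem_ofPred_eq, Set.mem_empty_iff_false, iff_false]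
    rintro ⟨-, hz⟩
    exact h ⟨z, hz⟩

theorem SimGame.semilinear {K : Type} [Fintype K] (G : SimGame K) (k : K) :
    IsSemilinearSubset {x : ℕ × ℕ | G.Black k (x.1 : ℤ) (x.2 : ℤ)} := by
  have hcol : ∀ i : ℕ, IsSemilinearSubset {x : ℕ × ℕ | x.1 = i ∧ G.Black k (i : ℤ) (x.2 : ℤ)} :=
    fun i => semilinear_column i (fun z => G.Black k (i : ℤ) (z : ℤ))
      fun z z' hz hzz => G.black_mono hz le_rfl (by exact_mod_cast hzz)
  by_cases hk : k ∈ G.Fin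
  · obtain ⟨n, m, b, hn, hm, hb, hper⟩ := G.periodic hk
    lift n to ℕ using hn
    lift m to ℕ using (by omega)
    lift b to ℕ using hb
    have hper' : ∀ i : ℕ, ∀ x : ℤ, n ≤ x → G.fr k (x + i * m) = G.fr k x + i * b := by
      intro i x hx
      induction i with
      | zero => simp
      | succ i ih =>
        have h1 := hper (x + i * m) (by
          have : (0 : ℤ) ≤ i * m := by positivity
          omega)
        push_cast
        rw [show x + ((i : ℤ) + 1) * m = x + i * m + m by ring, h1, ih]
        ring
    have hcone : ∀ r : ℕ, IsLinearSubset {x : ℕ × ℕ | ∃ i : ℕ, x.1 = n + r + i * m ∧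
        (G.fr k ((n + r : ℕ) : ℤ)).toNat + i * b ≤ x.2} :=
      fun r => linear_cone _ _ _ _ (by omega)
    convert (semilinear_biUnion n _ fun i _ => hcol i).union
      (semilinear_biUnion m _ fun r _ => (hcone r).semilinear) using 1
    have hcone' : ∀ r i z : ℕ, G.Black k ((n + r + i * m : ℕ) : ℤ) (z : ℤ) ↔
        (G.fr k ((n + r : ℕ) : ℤ)).toNat + i * b ≤ z := by
      intro r i z
      rw [SimGame.black_iff hk (by positivity)]
      have h1 := hper' i ((n + r : ℕ) : ℤ) (by push_cast; omega)
      have h2 := SimGame.fr_nonneg hk (x := ((n + r : ℕ) : ℤ)) (by positivity)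
      have h3 : ((n + r + i * m : ℕ) : ℤ) = ((n + r : ℕ) : ℤ) + i * m := by push_cast; ring
      rw [h3, h1]
      push_cast at h2
      zify
      rw [Int.toNat_of_nonneg h2]
    ext ⟨x, z⟩
    simp only [Set.mem_ofPred_eq, Set.mem_union]
    constructor
    · intro h
      by_cases hx : x < n
      · exact Or.inl ⟨x, hx, rfl, h⟩
      · right
        have h4 : x = n + (x - n) % m + (x - n) / m * m := by
          have := Nat.mod_add_div (x - n) m
          rw [mul_comm] at this
          omega
        refine ⟨(x - n) % m, Nat.mod_lt _ (by omega), (x - n) / m, h4, ?_⟩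
        rw [← hcone', ← h4]
        exact h
    · rintro (⟨i, hi, rfl, h⟩ | ⟨r, hr, i, rfl, h⟩)
      · exact h
      · exact (hcone' r i z).2 h
  · obtain ⟨X, hX0, hX⟩ := G.exists_threshold
    lift X to ℕ using hX0
    convert semilinear_biUnion X _ fun i _ => hcol i using 1
    ext ⟨x, z⟩
    simp only [Set.mem_ofPred_eq]
    constructor
    · intro h
      refine ⟨x, ?_, rfl, h⟩
      by_contra hx
      exact hk (hX k x z (by omega) h)
    · rintro ⟨i, hi, rfl, h⟩
      exact h

/-! ## The simulation game of two one-counter nets -/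

/-- The simulation game. -/
def OCN.game {Q Q' A : Type} (N : OCN Q A) (N' : OCN Q' A) : SimGame (Q × Q') where
  mv k := {p | ∃ a q1, N.δ k.1 a p.1 q1 ∧ p.2 = {o | o.2.1 = q1 ∧ N'.δ k.2 a o.1 o.2.2}}
  bd := by
    rintro k d O ⟨a, q1, h, -⟩
    have := N.effect_bounded _ _ _ _ h
    omega
  bo := by
    rintro k d O ⟨a, q1, -, h⟩ d' k' ho
    simp only at h
    subst h
    have := N'.effect_bounded _ _ _ _ ho.2
    omega

theorem OCN.simulates_iff {Q Q' A : Type} (N : OCN Q A) (N' : OCN Q' A) (q : Q) (q' : Q')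
    (x z : ℕ) : Simulates N.Step N'.Step (q, x) (q', z) ↔
      (N.game N').Black (q, q') (x : ℤ) (z : ℤ) := by
  constructor
  · rintro ⟨R, hR, h⟩
    refine ⟨fun k x z => ∃ m n : ℕ, x = m ∧ z = n ∧ R (k.1, m) (k.2, n), ?_, x, z, rfl, rfl, h⟩
    rintro ⟨p, p'⟩ x z ⟨m, n, rfl, rfl, h⟩ -
    refine ⟨by positivity, ?_⟩
    rintro d O ⟨a, q1, hd, hO⟩ hxd
    simp only at hd hO h
    subst hO
    obtain ⟨⟨p2, n2⟩, ⟨d', hd', he⟩, hr⟩ := hR _ _ h a (q1, ((m : ℤ) + d).toNat)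
      ⟨d, hd, Int.toNat_of_nonneg hxd⟩
    exact ⟨d', (q1, p2), ⟨rfl, hd'⟩, _, _, (Int.toNat_of_nonneg hxd).symm, he.symm, hr⟩
  · intro h
    refine ⟨fun c c' => (N.game N').Black (c.1, c'.1) (c.2 : ℤ) (c'.2 : ℤ), ?_, h⟩
    rintro ⟨p, m⟩ ⟨p', n⟩ hb a ⟨q1, m1⟩ ⟨d, hd, he⟩
    simp only at hb hd he
    have h1 := (N.game N').black_isSim _ _ _ hb (by positivity)
    obtain ⟨d', ⟨k1, k2⟩, ⟨ho1, ho2⟩, hb'⟩ := h1.2 d _ ⟨a, q1, hd, rfl⟩ (by omega)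
    simp only at ho1 ho2
    subst ho1
    rw [← he] at hb'
    have hnn := SimGame.black_nonneg (by positivity) hb'
    refine ⟨(k2, ((n : ℤ) + d').toNat), ⟨d', ho2, Int.toNat_of_nonneg hnn⟩, ?_⟩
    simp only
    rw [Int.toNat_of_nonneg hnn]
    exact hb'

/-- For any two one-counter nets `N` and `N'`, the maximal
strong simulation relation `⪯` is semilinear: for every pair `(q, q')` of
control states, the set `{(n, n') ∈ ℕ² : qn ⪯ q'n'}` is a finite union of
linear sets. -/
theorem strong_sim_semilinear {Q Q' A : Type} [Fintype Q] [Fintype Q'] [Fintype A]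
    (N : OCN Q A) (N' : OCN Q' A) (q : Q) (q' : Q') :
    IsSemilinearSubset {x : ℕ × ℕ | Simulates N.Step N'.Step (q, x.1) (q', x.2)} := by
  have h := (N.game N').semilinear (q, q')
  convert h using 1
  ext ⟨x, z⟩
  exact OCN.simulates_iff N N' q q' x z
end

section
/- Game characterization of approximants: For a one-counter net N and an ω-net N', Duplicator has a winning strategy in the approximant game starting in position (pm, p'm', α, β) if and only if pm ⪯^β_α p'm'. -/
/-- An ω-net: transitions carry an effect in `{-1,0,1}` (encoded `some d`)
or the symbolic effect `ω` (encoded `none`). -/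
structure OmegaNet (Q A : Type) where
  δ : Q → A → Option ℤ → Q → Prop
  effect_bounded : ∀ p a d q, δ p a (some d) q → d = -1 ∨ d = 0 ∨ d = 1

/-- Steps of the LTS induced by an ω-net: an ordinary transition changes the
counter by its effect; an `ω`-transition may increase it to any larger value. -/
def OmegaNet.Step {Q A : Type} (N : OmegaNet Q A) (c : Q × ℕ) (a : A) (c' : Q × ℕ) : Prop :=
  (∃ d : ℤ, N.δ c.1 a (some d) c'.1 ∧ (c'.2 : ℤ) = (c.2 : ℤ) + d) ∨
  (N.δ c.1 a none c'.1 ∧ c.2 < c'.2)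

/-- `Apx β α` is the family of approximants `⪯^β_α` between a one-counter net
and an ω-net (`β` bounds Duplicator's `ω`-steps, `α` bounds the number of
rounds), i.e. it satisfies the defining recurrences:
`⪯^0_α` and `⪯^β_0` are the full relation; at successors,
`pm ⪯^{β+1}_{α+1} p'm'` iff every Spoiler step has a response that is either
an `ω`-step whose result is in `⪯^β_α`, or an ordinary step whose result is in
`⪯^{β+1}_α`; and at limit ordinals the family is the intersection of the
preceding approximants. -/
def IsApxFamily {Q Q' A : Type} (N : OCN Q A) (N' : OmegaNet Q' A)
    (Apx : Ordinal → Ordinal → (Q × ℕ) → (Q' × ℕ) → Prop) : Prop :=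
  (∀ α c c', Apx 0 α c c') ∧
  (∀ β c c', Apx β 0 c c') ∧
  (∀ β α (p : Q) (m : ℕ) (p' : Q') (m' : ℕ),
    Apx (β + 1) (α + 1) (p, m) (p', m') ↔
      ∀ a (q : Q) (n : ℕ), N.Step (p, m) a (q, n) →
        ∃ (q' : Q') (n' : ℕ),
          (N'.δ p' a none q' ∧ m' < n' ∧ Apx β α (q, n) (q', n')) ∨
          (∃ d : ℤ, N'.δ p' a (some d) q' ∧ (n' : ℤ) = (m' : ℤ) + d ∧
            Apx (β + 1) α (q, n) (q', n'))) ∧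
  (∀ β α, Order.IsSuccLimit β → ∀ c c', (Apx β α c c' ↔ ∀ β' < β, Apx β' α c c')) ∧
  (∀ β α, Order.IsSuccLimit α → ∀ c c', (Apx β α c c' ↔ ∀ α' < α, Apx β α' c c'))

/-- Duplicator has a winning strategy in the approximant game from
`(c, c', α, β)`: there is a set `W` of game positions containing it and
closed under rounds of the game.  In a round from `(pm, p'm', γ, δ)` Spoiler
chooses ordinals `γ' < γ`, `δ' < δ` and a step `pm →a qn`; Duplicator
responds with a step `p'm' →a q'n'`, after which the game continues from
`(qn, q'n', γ', δ')` if the response used an `ω`-transition and from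
`(qn, q'n', γ', δ)` otherwise.  A player who cannot move loses, and
Duplicator wins as soon as one of the ordinals is `0` (this is built in:
the closure condition is vacuous there) and also wins all infinite plays
(there are none, as the ordinals strictly decrease). -/
def DupWinsApxGame {Q Q' A : Type} (N : OCN Q A) (N' : OmegaNet Q' A)
    (c : Q × ℕ) (c' : Q' × ℕ) (α β : Ordinal) : Prop :=
  ∃ W : (Q × ℕ) → (Q' × ℕ) → Ordinal → Ordinal → Prop,
    W c c' α β ∧
    ∀ (p : Q) (m : ℕ) (p' : Q') (m' : ℕ) (γ δ : Ordinal),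
      W (p, m) (p', m') γ δ →
      ∀ γ' < γ, ∀ δ' < δ, ∀ a (q : Q) (n : ℕ), N.Step (p, m) a (q, n) →
        ∃ (q' : Q') (n' : ℕ),
          (N'.δ p' a none q' ∧ m' < n' ∧ W (q, n) (q', n') γ' δ') ∨
          (∃ d : ℤ, N'.δ p' a (some d) q' ∧ (n' : ℤ) = (m' : ℤ) + d ∧
            W (q, n) (q', n') γ' δ)

theorem apx_mono_beta {Q Q' A : Type} {N : OCN Q A} {N' : OmegaNet Q' A}
    {Apx : Ordinal → Ordinal → (Q × ℕ) → (Q' × ℕ) → Prop}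
    (hApx : IsApxFamily N N' Apx) (α : Ordinal) :
    ∀ (β β' : Ordinal), β' ≤ β → ∀ c c', Apx β α c c' → Apx β' α c c' := by
  obtain ⟨h0, h0', hs, hlb, hla⟩ := hApx
  induction α using Ordinal.limitRecOn with
  | zero => intros; exact h0' _ _ _
  | limit α hα ih =>
    intro β β' hle c c' h
    rw [hla _ _ hα] at h ⊢
    intro a ha
    exact ih a ha β β' hle c c' (h a ha)
  | add_one γ ih =>
    intro β
    induction β using Ordinal.limitRecOn with
    | zero =>
      intro β' hle c c' h
      have : β' = 0 := le_antisymm hle zero_le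
      subst this; exact h
    | limit β hβ _ =>
      intro β' hle c c' h
      rcases hle.eq_or_lt with rfl | hlt
      · exact h
      · exact (hlb _ _ hβ _ _).1 h _ hlt
    | add_one b _ =>
      intro β'
      induction β' using Ordinal.limitRecOn with
      | zero => intros; exact h0 _ _ _
      | limit β' hβ' ih' =>
        intro hle c c' h
        rw [hlb _ _ hβ']
        intro b' hb'
        exact ih' b' hb' (hb'.le.trans hle) c c' h
      | add_one b' _ =>
        rintro hle ⟨p, m⟩ ⟨p', m'⟩ h
        have hbb : b' ≤ b := by simpa using hle
        refine (hs _ _ _ _ _ _).2 fun a q n st => ?_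
        obtain ⟨q', n', h | ⟨d, h1, h2, h3⟩⟩ := (hs _ _ _ _ _ _).1 h a q n st
        · exact ⟨q', n', Or.inl ⟨h.1, h.2.1, ih _ _ hbb _ _ h.2.2⟩⟩
        · exact ⟨q', n', Or.inr ⟨d, h1, h2, ih _ _ hle _ _ h3⟩⟩

theorem apx_mono_alpha {Q Q' A : Type} {N : OCN Q A} {N' : OmegaNet Q' A}
    {Apx : Ordinal → Ordinal → (Q × ℕ) → (Q' × ℕ) → Prop}
    (hApx : IsApxFamily N N' Apx) (α : Ordinal) :
    ∀ (α' : Ordinal), α' ≤ α → ∀ β c c', Apx β α c c' → Apx β α' c c' := by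
  obtain ⟨h0, h0', hs, hlb, hla⟩ := hApx
  induction α using Ordinal.limitRecOn with
  | zero =>
    intro α' hle β c c' h
    have : α' = 0 := le_antisymm hle zero_le
    subst this; exact h
  | limit α hα _ =>
    intro α' hle β c c' h
    rcases hle.eq_or_lt with rfl | hlt
    · exact h
    · exact (hla _ _ hα _ _).1 h _ hlt
  | add_one γ ih =>
    intro α'
    induction α' using Ordinal.limitRecOn with
    | zero => intros; exact h0' _ _ _
    | limit α' hα' ih' =>
      intro hle β c c' h
      rw [hla _ _ hα']
      intro b' hb'
      exact ih' b' hb' (hb'.le.trans hle) β c c' h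
    | add_one a' _ =>
      intro hle β
      have haa : a' ≤ γ := by simpa using hle
      induction β using Ordinal.limitRecOn with
      | zero => intros; exact h0 _ _ _
      | limit β hβ ihβ =>
        intro c c' h
        rw [hlb _ _ hβ] at h ⊢
        intro b hb
        exact ihβ b hb c c' (h b hb)
      | add_one b _ =>
        rintro ⟨p, m⟩ ⟨p', m'⟩ h
        refine (hs _ _ _ _ _ _).2 fun a q n st => ?_
        obtain ⟨q', n', h | ⟨d, h1, h2, h3⟩⟩ := (hs _ _ _ _ _ _).1 h a q n st
        · exact ⟨q', n', Or.inl ⟨h.1, h.2.1, ih _ haa _ _ _ h.2.2⟩⟩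
        · exact ⟨q', n', Or.inr ⟨d, h1, h2, ih _ haa _ _ _ h3⟩⟩

theorem apx_of_win {Q Q' A : Type} {N : OCN Q A} {N' : OmegaNet Q' A}
    {Apx : Ordinal → Ordinal → (Q × ℕ) → (Q' × ℕ) → Prop}
    (hApx : IsApxFamily N N' Apx)
    (W : (Q × ℕ) → (Q' × ℕ) → Ordinal → Ordinal → Prop)
    (hcl : ∀ (p : Q) (m : ℕ) (p' : Q') (m' : ℕ) (γ δ : Ordinal),
      W (p, m) (p', m') γ δ →
      ∀ γ' < γ, ∀ δ' < δ, ∀ a (q : Q) (n : ℕ), N.Step (p, m) a (q, n) →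
        ∃ (q' : Q') (n' : ℕ),
          (N'.δ p' a none q' ∧ m' < n' ∧ W (q, n) (q', n') γ' δ') ∨
          (∃ d : ℤ, N'.δ p' a (some d) q' ∧ (n' : ℤ) = (m' : ℤ) + d ∧
            W (q, n) (q', n') γ' δ)) (α : Ordinal) :
    ∀ c c' γ δ, W c c' γ δ → α ≤ γ → ∀ β ≤ δ, Apx β α c c' := by
  obtain ⟨h0, h0', hs, hlb, hla⟩ := hApx
  induction α using Ordinal.limitRecOn with
  | zero => intros; exact h0' _ _ _
  | limit α hα ih =>
    intro c c' γ δ hW hle β hβ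
    rw [hla _ _ hα]
    intro a ha
    exact ih a ha c c' γ δ hW (ha.le.trans hle) β hβ
  | add_one a ih =>
    intro c c' γ δ hW hle β
    induction β using Ordinal.limitRecOn with
    | zero => intros; exact h0 _ _ _
    | limit β hβ ihβ =>
      intro hle'
      rw [hlb _ _ hβ]
      intro b hb
      exact ihβ b hb (hb.le.trans hle')
    | add_one b _ =>
      intro hle'
      obtain ⟨p, m⟩ := c
      obtain ⟨p', m'⟩ := c'
      refine (hs _ _ _ _ _ _).2 fun l q n st => ?_
      have ha : a < γ := Order.succ_le_iff.1 (by simpa using hle)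
      have hb : b < δ := Order.succ_le_iff.1 (by simpa using hle')
      obtain ⟨q', n', h | ⟨d, h1, h2, h3⟩⟩ := hcl _ _ _ _ _ _ hW a ha b hb l q n st
      · exact ⟨q', n', Or.inl ⟨h.1, h.2.1, ih _ _ _ _ h.2.2 le_rfl _ le_rfl⟩⟩
      · exact ⟨q', n', Or.inr ⟨d, h1, h2, ih _ _ _ _ h3 le_rfl _ hle'⟩⟩

theorem apx_round {Q Q' A : Type} [Fintype Q'] {N : OCN Q A} {N' : OmegaNet Q' A}
    {Apx : Ordinal → Ordinal → (Q × ℕ) → (Q' × ℕ) → Prop}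
    (hApx : IsApxFamily N N' Apx) {p : Q} {m : ℕ} {p' : Q'} {m' : ℕ}
    {γ γ' δ δ' : Ordinal} (h : Apx δ γ (p, m) (p', m')) (hγ : γ' < γ) (hδ : δ' < δ)
    (a : A) (q : Q) (n : ℕ) (st : N.Step (p, m) a (q, n)) :
    ∃ (q' : Q') (n' : ℕ),
      (N'.δ p' a none q' ∧ m' < n' ∧ Apx δ' γ' (q, n) (q', n')) ∨
      (∃ d : ℤ, N'.δ p' a (some d) q' ∧ (n' : ℤ) = (m' : ℤ) + d ∧
        Apx δ γ' (q, n) (q', n')) := by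
  have mb := apx_mono_beta hApx
  have h1 : Apx δ (γ' + 1) (p, m) (p', m') :=
    apx_mono_alpha hApx γ _ (by simpa using Order.succ_le_of_lt hγ) _ _ _ h
  obtain ⟨h0, h0', hs, hlb, hla⟩ := hApx
  induction δ using Ordinal.limitRecOn with
  | zero => exact absurd hδ (by simp)
  | add_one b _ =>
    have hb : δ' ≤ b := by simpa using hδ
    obtain ⟨q', n', h | h⟩ := (hs _ _ _ _ _ _).1 h1 a q n st
    · exact ⟨q', n', Or.inl ⟨h.1, h.2.1, mb _ _ _ hb _ _ h.2.2⟩⟩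
    · exact ⟨q', n', Or.inr h⟩
  | limit δ hlim _ =>
    -- finitely many ordinary responses: one bound below `δ` decides all of them
    have key : ∀ r : Q' × ℕ, ∃ b < δ, (Apx b γ' (q, n) r → Apx δ γ' (q, n) r) := by
      intro r
      by_cases hr : Apx δ γ' (q, n) r
      · exact ⟨δ', hδ, fun _ => hr⟩
      · have hr' := hr
        rw [hlb _ _ hlim] at hr'
        push Not at hr'
        obtain ⟨b, hb, hn⟩ := hr'
        exact ⟨b, hb, fun h => absurd h hn⟩
    choose f hf hf' using key
    let S : Finset (Q' × ℕ) := Finset.univ ×ˢ Finset.range (m' + 2)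
    have hpos : (⊥ : Ordinal) < δ := lt_of_le_of_lt bot_le hδ
    have hsup : S.sup f < δ := (Finset.sup_lt_iff hpos).2 fun r _ => hf r
    have hmax : max δ' (S.sup f) < δ := max_lt hδ hsup
    have h2 := (hlb _ _ hlim _ _).1 h1 _ (hlim.succ_lt hmax)
    rw [Order.succ_eq_add_one] at h2
    obtain ⟨q', n', h | ⟨d, h3, h4, h5⟩⟩ := (hs _ _ _ _ _ _).1 h2 a q n st
    · exact ⟨q', n', Or.inl ⟨h.1, h.2.1, mb _ _ _ (le_max_left _ _) _ _ h.2.2⟩⟩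
    · refine ⟨q', n', Or.inr ⟨d, h3, h4, hf' _ (mb _ _ _ ?_ _ _ h5)⟩⟩
      have hmem : (q', n') ∈ S := by
        have := N'.effect_bounded _ _ _ _ h3
        simp only [S, Finset.mem_product, Finset.mem_univ, Finset.mem_range, true_and]
        omega
      have h6 : f (q', n') ≤ S.sup f := Finset.le_sup hmem
      exact (h6.trans (le_max_right _ _)).trans (Order.lt_add_one_iff.2 le_rfl).le

/-- **Game characterization.** For a one-counter net `N` and
an ω-net `N'`, Duplicator has a winning strategy in the approximant game
starting in position `(pm, p'm', α, β)` if and only if `pm ⪯^β_α p'm'`. -/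
theorem approximant_game_characterization {Q Q' A : Type}
    [Fintype Q] [Fintype Q'] [Fintype A]
    (N : OCN Q A) (N' : OmegaNet Q' A)
    (Apx : Ordinal → Ordinal → (Q × ℕ) → (Q' × ℕ) → Prop)
    (hApx : IsApxFamily N N' Apx)
    (c : Q × ℕ) (c' : Q' × ℕ) (α β : Ordinal) :
    DupWinsApxGame N N' c c' α β ↔ Apx β α c c' := by
  constructor
  · rintro ⟨W, hW, hcl⟩
    exact apx_of_win hApx W hcl α c c' α β hW le_rfl β le_rfl
  · intro h
    refine ⟨fun c c' α β => Apx β α c c', h, ?_⟩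
    intro p m p' m' γ δ h γ' hγ δ' hδ
    exact apx_round hApx h hγ hδ
end

section
/- For the approximants ⪯^β_α between a one-counter net and an ω-net, the following hold for all ordinals α, β: (1) pm ⪯^β_α p'm' implies pn ⪯^β_α p'n' for all n ≤ m and n' ≥ m'; (2) if α̂ ≥ α and β̂ ≥ β then ⪯^β̂_α̂ ⊆ ⪯^β_α; and (3) ⪯ = ⋂_α ⪯_α = ⋂_β ⪯^β, where ⪯ is the strong simulation preorder, ⪯^β = ⋂_{α ∈ Ord} ⪯^β_α and ⪯_α = ⋂_{β ∈ Ord} ⪯^β_α. -/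
/-- Double induction on `α`, then `β`, along the clauses of the approximants. -/
theorem apx_double_induction {P : Ordinal → Ordinal → Prop}
    (h0 : ∀ α, P 0 α) (h0' : ∀ β, P β 0)
    (hs : ∀ β α, P β α → P (β + 1) α → P (β + 1) (α + 1))
    (hb : ∀ β α, Order.IsSuccLimit β → (∀ β' < β, P β' α) → P β α)
    (ha : ∀ β α, Order.IsSuccLimit α → (∀ α' < α, P β α') → P β α)
    (β α : Ordinal) : P β α := by
  induction α using Ordinal.limitRecOn generalizing β with
  | zero => exact h0' β
  | limit α hα ih => exact ha β α hα fun α' h => ih α' h β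
  | add_one α ih =>
    induction β using Ordinal.limitRecOn with
    | zero => exact h0 _
    | limit β hβ ih' => exact hb β _ hβ ih'
    | add_one β ih' => exact hs β α (ih _) (ih _)

/-- Every nonzero ordinal is a successor or a limit. -/
theorem ordinal_succ_or_limit (o b : Ordinal) (h : b + 1 ≤ o) :
    (∃ a, b ≤ a ∧ o = a + 1) ∨ Order.IsSuccLimit o := by
  induction o using Ordinal.limitRecOn with
  | zero => simp at h
  | limit o ho _ => exact Or.inr ho
  | add_one o _ => exact Or.inl ⟨o, by simpa using h, by simp⟩

/-- Properties of the approximants `⪯^β_α` between a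
one-counter net and an ω-net, for all ordinals `α, β`:
(1) `pm ⪯^β_α p'm'` implies `pn ⪯^β_α p'n'` for `n ≤ m` and `n' ≥ m'`;
(2) if `α̂ ≥ α` and `β̂ ≥ β` then `⪯^β̂_α̂ ⊆ ⪯^β_α`;
(3) `⪯ = ⋂_α ⪯_α = ⋂_β ⪯^β` where `⪯` is the strong simulation preorder,
`⪯^β = ⋂_α ⪯^β_α` and `⪯_α = ⋂_β ⪯^β_α`. -/
theorem approximant_properties {Q Q' A : Type}
    [Fintype Q] [Fintype Q'] [Fintype A]
    (N : OCN Q A) (N' : OmegaNet Q' A)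
    (Apx : Ordinal → Ordinal → (Q × ℕ) → (Q' × ℕ) → Prop)
    (hApx : IsApxFamily N N' Apx) :
    (∀ (β α : Ordinal) (p : Q) (m n : ℕ) (p' : Q') (m' n' : ℕ),
      Apx β α (p, m) (p', m') → n ≤ m → m' ≤ n' → Apx β α (p, n) (p', n')) ∧
    (∀ (β β' α α' : Ordinal), β ≤ β' → α ≤ α' →
      ∀ c c', Apx β' α' c c' → Apx β α c c') ∧
    (∀ c c',
      (Simulates N.Step N'.Step c c' ↔ ∀ α β, Apx β α c c') ∧
      (Simulates N.Step N'.Step c c' ↔ ∀ β α, Apx β α c c')) := by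
  obtain ⟨h0, h0', hs, hb, ha⟩ := hApx
  have counter : ∀ (β α : Ordinal) (p : Q) (m n : ℕ) (p' : Q') (m' n' : ℕ),
      Apx β α (p, m) (p', m') → n ≤ m → m' ≤ n' → Apx β α (p, n) (p', n') := by
    intro β α
    refine apx_double_induction (P := fun β α => ∀ (p : Q) (m n : ℕ) (p' : Q') (m' n' : ℕ),
      Apx β α (p, m) (p', m') → n ≤ m → m' ≤ n' → Apx β α (p, n) (p', n'))
      ?_ ?_ ?_ ?_ ?_ β α
    · intros; exact h0 _ _ _
    · intros; exact h0' _ _ _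
    · intro β α ih1 ih2 p m n p' m' n' h hn hn'
      rw [hs] at h ⊢
      rintro a q k ⟨d, hd, hk⟩
      simp only at hd hk
      obtain ⟨q', k', hr⟩ := h a q (k + (m - n)) ⟨d, hd, by simp only; omega⟩
      rcases hr with ⟨hw, hlt, hR⟩ | ⟨e, he, hk', hR⟩
      · exact ⟨q', k' + n', Or.inl ⟨hw, by omega, ih1 _ _ _ _ _ _ hR (by omega) (by omega)⟩⟩
      · exact ⟨q', k' + (n' - m'), Or.inr ⟨e, he, by omega,
          ih2 _ _ _ _ _ _ hR (by omega) (by omega)⟩⟩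
    · intro β α hl ih p m n p' m' n' h hn hn'
      rw [hb _ _ hl] at h ⊢
      exact fun b hb' => ih b hb' _ _ _ _ _ _ (h b hb') hn hn'
    · intro β α hl ih p m n p' m' n' h hn hn'
      rw [ha _ _ hl] at h ⊢
      exact fun b hb' => ih b hb' _ _ _ _ _ _ (h b hb') hn hn'
  have mono : ∀ (β β' α α' : Ordinal), β ≤ β' → α ≤ α' →
      ∀ c c', Apx β' α' c c' → Apx β α c c' := by
    intro β β' α α'
    refine apx_double_induction (P := fun β α => ∀ β' α', β ≤ β' → α ≤ α' →
      ∀ c c', Apx β' α' c c' → Apx β α c c') ?_ ?_ ?_ ?_ ?_ β α β' α'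
    · intros; exact h0 _ _ _
    · intros; exact h0' _ _ _
    · rintro β α ih1 ih2 β' α' hβ hα ⟨p, m⟩ ⟨p', m'⟩ h
      have key : ∀ b a, β ≤ b → α ≤ a → Apx (b + 1) (a + 1) (p, m) (p', m') →
          Apx (β + 1) (α + 1) (p, m) (p', m') := by
        intro b a hβ hα h
        rw [hs] at h ⊢
        intro x q n hst
        obtain ⟨q', n', ⟨hw, hlt, hR⟩ | ⟨e, he, hk', hR⟩⟩ := h x q n hst
        · exact ⟨q', n', Or.inl ⟨hw, hlt, ih1 _ _ hβ hα _ _ hR⟩⟩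
        · exact ⟨q', n', Or.inr ⟨e, he, hk', ih2 _ _ (by gcongr) hα _ _ hR⟩⟩
      have key2 : ∀ b, β ≤ b → Apx (b + 1) α' (p, m) (p', m') →
          Apx (β + 1) (α + 1) (p, m) (p', m') := by
        intro b hb1 h
        rcases ordinal_succ_or_limit α' α hα with ⟨a, haa, rfl⟩ | hl
        · exact key b a hb1 haa h
        · rcases hα.eq_or_lt with rfl | hlt
          · exact key b α hb1 le_rfl h
          · exact key b α hb1 le_rfl ((ha _ _ hl _ _).1 h _ hlt)
      rcases ordinal_succ_or_limit β' β hβ with ⟨b, hbb, rfl⟩ | hl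
      · exact key2 b hbb h
      · rcases hβ.eq_or_lt with rfl | hlt
        · exact key2 β le_rfl h
        · exact key2 β le_rfl ((hb _ _ hl _ _).1 h _ hlt)
    · intro β α hl ih β' α' hβ hα c c' h
      rw [hb _ _ hl]
      exact fun b hb' => ih b hb' _ _ (hb'.le.trans hβ) hα _ _ h
    · intro β α hl ih β' α' hβ hα c c' h
      rw [ha _ _ hl]
      exact fun b hb' => ih b hb' _ _ hβ (hb'.le.trans hα) _ _ h
  have main : ∀ c c', Simulates N.Step N'.Step c c' ↔ ∀ β α, Apx β α c c' := by
    intro c c'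
    constructor
    · rintro ⟨R, hR, hc⟩ β α
      refine apx_double_induction (P := fun β α => ∀ c c', R c c' → Apx β α c c')
        ?_ ?_ ?_ ?_ ?_ β α c c' hc
      · intros; exact h0 _ _ _
      · intros; exact h0' _ _ _
      · rintro β α ih1 ih2 ⟨p, m⟩ ⟨p', m'⟩ h
        rw [hs]
        intro a q n hst
        obtain ⟨⟨q', n'⟩, ⟨d, hd, hn⟩ | ⟨hw, hlt⟩, hr⟩ := hR _ _ h a _ hst
        · exact ⟨q', n', Or.inr ⟨d, hd, hn, ih2 _ _ hr⟩⟩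
        · exact ⟨q', n', Or.inl ⟨hw, hlt, ih1 _ _ hr⟩⟩
      · intro β α hl ih c c' h
        rw [hb _ _ hl]
        exact fun b hb' => ih b hb' _ _ h
      · intro β α hl ih c c' h
        rw [ha _ _ hl]
        exact fun b hb' => ih b hb' _ _ h
    · intro h
      refine ⟨fun c c' => ∀ β α, Apx β α c c', ?_, h⟩
      rintro ⟨p, m⟩ ⟨p', m'⟩ h a ⟨q, n⟩ hst
      by_contra hcon
      push Not at hcon
      have hex : ∀ e : Q' × ℕ, ∃ β α, N'.Step (p', m') a e → ¬ Apx β α (q, n) e := by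
        intro e
        by_cases he : N'.Step (p', m') a e
        · obtain ⟨β, α, hne⟩ := hcon e he
          exact ⟨β, α, fun _ => hne⟩
        · exact ⟨0, 0, fun h => absurd h he⟩
      choose f g hfg using hex
      have hf : ∀ e, f e ≤ iSup f := fun e => Ordinal.le_iSup f e
      have hg : ∀ e, g e ≤ iSup g := fun e => Ordinal.le_iSup g e
      obtain ⟨q', n', ⟨hw, hlt, hR⟩ | ⟨d, hd, hk', hR⟩⟩ :=
        (hs (iSup f) (iSup g) p m p' m').1 (h _ _) a q n hst
      · exact hfg (q', n') (Or.inr ⟨hw, hlt⟩) (mono _ _ _ _ (hf _) (hg _) _ _ hR)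
      · exact hfg (q', n') (Or.inl ⟨d, hd, hk'⟩)
          (mono _ _ _ _ ((hf _).trans le_self_add) (hg _) _ _ hR)
  exact ⟨counter, mono, fun c c' =>
    ⟨(main c c').trans ⟨fun h α β => h β α, fun h β α => h α β⟩, main c c'⟩⟩
end

section
/- For any one-counter net N=(Q,Act,δ) and ω-net N'=(Q',Act,δ') there is a fixed bound c ∈ ℕ such that for all pairs of states (p,p') ∈ Q×Q', all naturals n > m > c, and all ordinals α: if there exists m' with pm ⪯_α p'm', then there exists n' with pn ⪯_α p'n'. -/
theorem apx_mono_left {Q Q' A : Type} {N : OCN Q A} {N' : OmegaNet Q' A}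
    {Apx : Ordinal → Ordinal → (Q × ℕ) → (Q' × ℕ) → Prop}
    (h : IsApxFamily N N' Apx) (α : Ordinal) :
    ∀ β (p : Q) (p' : Q') (m n m' : ℕ), n ≤ m → Apx β α (p, m) (p', m') →
      Apx β α (p, n) (p', m') := by
  obtain ⟨h0, h1, hs, hl, hl'⟩ := h
  induction α using Ordinal.limitRecOn with
  | zero => intros; exact h1 _ _ _
  | limit α hα ih =>
    intro β p p' m n m' hnm hA
    rw [hl' β α hα] at hA ⊢
    exact fun α' hlt => ih α' hlt β p p' m n m' hnm (hA α' hlt)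
  | add_one α ih =>
    intro β
    induction β using Ordinal.limitRecOn with
    | zero => intros; exact h0 _ _ _
    | limit β hβ ihβ =>
      intro p p' m n m' hnm hA
      rw [hl β _ hβ] at hA ⊢
      exact fun β' hlt => ihβ β' hlt p p' m n m' hnm (hA β' hlt)
    | add_one β ihβ =>
      intro p p' m n m' hnm hA
      rw [hs] at hA ⊢
      rintro a q k ⟨d, hd, hk⟩
      simp only at hd hk
      obtain ⟨q', n', H⟩ := hA a q (k + (m - n)) ⟨d, hd, by simp only; omega⟩
      refine ⟨q', n', ?_⟩
      rcases H with ⟨e1, e2, e3⟩ | ⟨d', e1, e2, e3⟩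
      · exact Or.inl ⟨e1, e2, ih _ _ _ _ _ _ (by omega) e3⟩
      · exact Or.inr ⟨d', e1, e2, ih _ _ _ _ _ _ (by omega) e3⟩

theorem apx_anti_right {Q Q' A : Type} {N : OCN Q A} {N' : OmegaNet Q' A}
    {Apx : Ordinal → Ordinal → (Q × ℕ) → (Q' × ℕ) → Prop}
    (h : IsApxFamily N N' Apx) (γ : Ordinal) :
    ∀ α, γ ≤ α → ∀ β (c : Q × ℕ) (c' : Q' × ℕ), Apx β α c c' → Apx β γ c c' := by
  obtain ⟨h0, h1, hs, hl, hl'⟩ := h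
  induction γ using Ordinal.limitRecOn with
  | zero => intros; exact h1 _ _ _
  | limit γ hγ ih =>
    intro α hα β c c' hA
    rw [hl' β γ hγ]
    exact fun γ' hlt => ih γ' hlt α (hlt.le.trans hα) β c c' hA
  | add_one γ ih =>
    intro α hα β
    rcases Ordinal.zero_or_succ_or_isSuccLimit α with rfl | ⟨ξ, rfl⟩ | hlim
    · simp at hα
    · try simp only [← Ordinal.add_one_eq_succ] at hα ⊢
      have hγξ : γ ≤ ξ := by simpa using hα
      induction β using Ordinal.limitRecOn with
      | zero => intros; exact h0 _ _ _
      | limit β hβ ihβ =>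
        intro c c' hA
        rw [hl β _ hβ] at hA ⊢
        exact fun β' hlt => ihβ β' hlt c c' (hA β' hlt)
      | add_one β ihβ =>
        rintro ⟨p, m⟩ ⟨p', m'⟩ hA
        rw [hs] at hA ⊢
        intro a q k hk
        obtain ⟨q', n', H⟩ := hA a q k hk
        refine ⟨q', n', ?_⟩
        rcases H with ⟨e1, e2, e3⟩ | ⟨d', e1, e2, e3⟩
        · exact Or.inl ⟨e1, e2, ih _ hγξ _ _ _ e3⟩
        · exact Or.inr ⟨d', e1, e2, ih _ hγξ _ _ _ e3⟩
    · intro c c' hA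
      rcases hα.eq_or_lt with rfl | hlt
      · exact hA
      · exact (hl' β α hlim c c').1 hA _ hlt

/-- For any one-counter net `N` and ω-net `N'` there is a
fixed bound `c ∈ ℕ` such that for all pairs of states `(p, p')`, all naturals
`n > m > c` and all ordinals `α`: if there exists `m'` with `pm ⪯_α p'm'`
(where `⪯_α = ⋂_β ⪯^β_α`), then there exists `n'` with `pn ⪯_α p'n'`. -/
theorem uniformity_bound {Q Q' A : Type}
    [Fintype Q] [Fintype Q'] [Fintype A]
    (N : OCN Q A) (N' : OmegaNet Q' A)
    (Apx : Ordinal → Ordinal → (Q × ℕ) → (Q' × ℕ) → Prop)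
    (hApx : IsApxFamily N N' Apx) :
    ∃ c : ℕ, ∀ (p : Q) (p' : Q') (m n : ℕ), c < m → m < n →
      ∀ α : Ordinal,
        (∃ m' : ℕ, ∀ β, Apx β α (p, m) (p', m')) →
        (∃ n' : ℕ, ∀ β, Apx β α (p, n) (p', n')) := by
  have key : ∀ x : Q × Q', ∃ c : ℕ, ∀ m n : ℕ, c ≤ m → ∀ α : Ordinal,
      (∃ m' : ℕ, ∀ β, Apx β α (x.1, m) (x.2, m')) →
      (∃ n' : ℕ, ∀ β, Apx β α (x.1, n) (x.2, n')) := by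
    rintro ⟨p, p'⟩
    by_cases hne : ∃ α : Ordinal, ∃ m : ℕ, ¬ ∃ m' : ℕ, ∀ β, Apx β α (p, m) (p', m')
    · let S : Set Ordinal := {α | ∃ m : ℕ, ¬ ∃ m' : ℕ, ∀ β, Apx β α (p, m) (p', m')}
      have hS : S.Nonempty := hne
      obtain ⟨c, hc⟩ : sInf S ∈ S := csInf_mem hS
      refine ⟨c, fun m n hcm α => ?_⟩
      rintro ⟨m', hm'⟩
      by_contra hn
      have hle : sInf S ≤ α := csInf_le' ⟨n, hn⟩
      exact hc ⟨m', fun β => apx_anti_right hApx _ _ hle _ _ _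
        (apx_mono_left hApx _ _ _ _ _ _ _ hcm (hm' β))⟩
    · push Not at hne
      exact ⟨0, fun m n _ α _ => hne α n⟩
  choose f hf using key
  refine ⟨Finset.univ.sup f, fun p p' m n hm _ α hex => hf (p, p') m n ?_ α hex⟩
  exact (Finset.le_sup (f := f) (Finset.mem_univ (p, p'))).trans hm.le
end

section
/- For strong simulation ⪯ between a one-counter net N=(Q,Act,δ) and an ω-net N'=(Q',Act,δ'), there exists a constant CB ∈ ℕ such that ⪯ = ⪯^CB; that is, the approximants ⪯^β converge to the simulation preorder at some finite level CB. -/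
universe u

/-- The finitely-indexed part of an approximant family. -/
structure FinApx {Q Q' A : Type} (N : OCN Q A) (N' : OmegaNet Q' A)
    (F : ℕ → Ordinal.{u} → (Q × ℕ) → (Q' × ℕ) → Prop) : Prop where
  h0 : ∀ α c c', F 0 α c c'
  hz : ∀ k c c', F k 0 c c'
  hs : ∀ k α (p : Q) (m : ℕ) (p' : Q') (m' : ℕ),
    F (k + 1) (α + 1) (p, m) (p', m') ↔
      ∀ a (q : Q) (n : ℕ), N.Step (p, m) a (q, n) →
        ∃ (q' : Q') (n' : ℕ),
          (N'.δ p' a none q' ∧ m' < n' ∧ F k α (q, n) (q', n')) ∨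
          (∃ d : ℤ, N'.δ p' a (some d) q' ∧ (n' : ℤ) = (m' : ℤ) + d ∧
            F (k + 1) α (q, n) (q', n'))
  hl : ∀ k α, Order.IsSuccLimit α → ∀ c c', (F k α c c' ↔ ∀ α' < α, F k α' c c')

namespace FinApx

variable {Q Q' A : Type} {N : OCN Q A} {N' : OmegaNet Q' A}
  {F : ℕ → Ordinal.{u} → (Q × ℕ) → (Q' × ℕ) → Prop}

theorem anti_ord (H : FinApx N N' F) (α : Ordinal.{u}) :
    ∀ α', α ≤ α' → ∀ k c c', F k α' c c' → F k α c c' := by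
  induction α using Ordinal.limitRecOn with
  | zero => intro _ _ k c c' _; exact H.hz k c c'
  | add_one α ih =>
    intro α' hle k c c' h
    rcases Nat.eq_zero_or_pos k with rfl | hk
    · exact H.h0 _ _ _
    obtain ⟨k, rfl⟩ := Nat.exists_eq_succ_of_ne_zero hk.ne'
    rcases Ordinal.zero_or_succ_or_isSuccLimit α' with rfl | ⟨γ, rfl⟩ | hlim
    · exact absurd hle (by simp)
    · obtain ⟨p, m⟩ := c
      obtain ⟨p', m'⟩ := c'
      have hle' : α ≤ γ := by
        rw [← Order.succ_eq_add_one] at hle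
        exact Order.succ_le_succ_iff.mp hle
      refine (H.hs k α p m p' m').2 ?_
      intro a q n hst
      obtain ⟨q', n', h1 | ⟨d, h1, h2, h3⟩⟩ := (H.hs k γ p m p' m').1 h a q n hst
      · exact ⟨q', n', Or.inl ⟨h1.1, h1.2.1, ih γ hle' _ _ _ h1.2.2⟩⟩
      · exact ⟨q', n', Or.inr ⟨d, h1, h2, ih γ hle' _ _ _ h3⟩⟩
    · rcases hle.lt_or_eq with hlt | rfl
      · exact (H.hl _ _ hlim c c').1 h _ hlt
      · exact h
  | limit α hα ih =>
    intro α' hle k c c' h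
    refine (H.hl _ _ hα c c').2 ?_
    intro γ hγ
    exact ih γ hγ α' (hγ.le.trans hle) k c c' h

theorem anti_nat_succ (H : FinApx N N' F) (α : Ordinal.{u}) :
    ∀ k c c', F (k + 1) α c c' → F k α c c' := by
  induction α using Ordinal.limitRecOn with
  | zero => intro k c c' _; exact H.hz k c c'
  | add_one α ih =>
    rintro (_ | k) ⟨p, m⟩ ⟨p', m'⟩ h
    · exact H.h0 _ _ _
    refine (H.hs k α p m p' m').2 ?_
    intro a q n hst
    obtain ⟨q', n', h1 | ⟨d, h1, h2, h3⟩⟩ := (H.hs (k + 1) α p m p' m').1 h a q n hst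
    · exact ⟨q', n', Or.inl ⟨h1.1, h1.2.1, ih _ _ _ h1.2.2⟩⟩
    · exact ⟨q', n', Or.inr ⟨d, h1, h2, ih _ _ _ h3⟩⟩
  | limit α hα ih =>
    intro k c c' h
    refine (H.hl _ _ hα c c').2 ?_
    intro γ hγ
    exact ih γ hγ k c c' ((H.hl _ _ hα c c').1 h γ hγ)

theorem anti_nat (H : FinApx N N' F) (α : Ordinal.{u}) {j k : ℕ} (hjk : j ≤ k) (c c') :
    F k α c c' → F j α c c' := by
  induction hjk with
  | refl => exact id
  | step _ ih => exact fun h => ih (H.anti_nat_succ α _ _ _ h)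

theorem mono (H : FinApx N N' F) (α : Ordinal.{u}) :
    ∀ k p m p' m' n n', n ≤ m → m' ≤ n' → F k α (p, m) (p', m') → F k α (p, n) (p', n') := by
  induction α using Ordinal.limitRecOn with
  | zero => intros; exact H.hz _ _ _
  | add_one α ih =>
    rintro (_ | k) p m p' m' n n' hn hm h
    · exact H.h0 _ _ _
    refine (H.hs k α p n p' n').2 ?_
    rintro a q l ⟨e, he, hl⟩
    simp only at he hl
    have hst : N.Step (p, m) a (q, l + (m - n)) := ⟨e, he, by simp only; omega⟩
    obtain ⟨q', r, h1 | ⟨d, h1, h2, h3⟩⟩ := (H.hs k α p m p' m').1 h a q _ hst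
    · exact ⟨q', max r (n' + 1), Or.inl ⟨h1.1, by omega,
        ih _ _ _ _ _ _ _ (by omega) (by omega) h1.2.2⟩⟩
    · exact ⟨q', r + (n' - m'), Or.inr ⟨d, h1, by omega,
        ih _ _ _ _ _ _ _ (by omega) (by omega) h3⟩⟩
  | limit α hα ih =>
    intro k p m p' m' n n' hn hm h
    refine (H.hl _ _ hα _ _).2 ?_
    intro γ hγ
    exact ih γ hγ _ _ _ _ _ _ _ hn hm ((H.hl _ _ hα _ _).1 h γ hγ)

theorem exists_stable (H : FinApx N N' F) (k : ℕ) :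
    ∃ α : Ordinal.{u}, ∀ c c', F k α c c' → ∀ γ, F k γ c c' := by
  classical
  have hx : ∀ x : (Q × ℕ) × (Q' × ℕ), ∃ α : Ordinal.{u},
      F k α x.1 x.2 → ∀ γ, F k γ x.1 x.2 := by
    intro x
    by_cases h : ∀ γ, F k γ x.1 x.2
    · exact ⟨0, fun _ => h⟩
    · push Not at h
      obtain ⟨γ, hγ⟩ := h
      exact ⟨γ, fun h' => absurd h' hγ⟩
  choose f hf using hx
  have hb : BddAbove (Set.range f) := Ordinal.bddAbove_of_small
  refine ⟨⨆ x, f x, fun c c' h => hf (c, c') ?_⟩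
  exact H.anti_ord _ _ (le_ciSup hb (c, c')) k c c' h

/-- The key unfolding of the limit relation. -/
theorem unfold (H : FinApx N N' F) (k : ℕ) (p : Q) (m : ℕ) (p' : Q') (m' : ℕ)
    (h : ∀ α, F (k + 1) α (p, m) (p', m')) (a : A) (q : Q) (n : ℕ)
    (hst : N.Step (p, m) a (q, n)) :
    ∃ (q' : Q') (n' : ℕ),
      (N'.δ p' a none q' ∧ m' < n' ∧ ∀ α, F k α (q, n) (q', n')) ∨
      (∃ d : ℤ, N'.δ p' a (some d) q' ∧ (n' : ℤ) = (m' : ℤ) + d ∧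
        ∀ α, F (k + 1) α (q, n) (q', n')) := by
  obtain ⟨α₁, h₁⟩ := H.exists_stable k
  obtain ⟨α₂, h₂⟩ := H.exists_stable (k + 1)
  obtain ⟨q', r, g | ⟨d, g1, g2, g3⟩⟩ :=
    (H.hs k (max α₁ α₂) p m p' m').1 (h _) a q n hst
  · exact ⟨q', r, Or.inl ⟨g.1, g.2.1, h₁ _ _ (H.anti_ord _ _ (le_max_left _ _) _ _ _ g.2.2)⟩⟩
  · exact ⟨q', r, Or.inr ⟨d, g1, g2, h₂ _ _ (H.anti_ord _ _ (le_max_right _ _) _ _ _ g3)⟩⟩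

theorem of_sim (H : FinApx N N' F) (R : Q × ℕ → Q' × ℕ → Prop)
    (hR : IsSimulation N.Step N'.Step R) (α : Ordinal.{u}) :
    ∀ k c c', R c c' → F k α c c' := by
  induction α using Ordinal.limitRecOn with
  | zero => intros; exact H.hz _ _ _
  | add_one α ih =>
    rintro (_ | k) ⟨p, m⟩ ⟨p', m'⟩ h
    · exact H.h0 _ _ _
    refine (H.hs k α p m p' m').2 ?_
    intro a q n hst
    obtain ⟨⟨q', n'⟩, ⟨d, h1, h2⟩ | ⟨h1, h2⟩, h3⟩ := hR _ _ h a (q, n) hst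
    · exact ⟨q', n', Or.inr ⟨d, h1, h2, ih _ _ _ h3⟩⟩
    · exact ⟨q', n', Or.inl ⟨h1, h2, ih _ _ _ h3⟩⟩
  | limit α hα ih =>
    intro k c c' h
    exact (H.hl _ _ hα _ _).2 fun γ hγ => ih γ hγ k c c' h

theorem exists_level (H : FinApx N N' F) (q : Q) (q' : Q') :
    ∃ K : ℕ, ∀ n, (∃ n', ∀ α, F K α (q, n) (q', n')) →
      ∀ j, ∃ n', ∀ α, F j α (q, n) (q', n') := by
  classical
  by_cases hex : ∃ n, ∃ j, ¬ ∃ n', ∀ α, F j α (q, n) (q', n')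
  · obtain ⟨K, hK⟩ := Nat.find_spec hex
    refine ⟨K, fun n hn j => ?_⟩
    by_contra hj
    have hle : Nat.find hex ≤ n := Nat.find_min' hex ⟨j, hj⟩
    obtain ⟨n', hn'⟩ := hn
    exact hK ⟨n', fun α => H.mono α _ _ _ _ _ _ _ hle le_rfl (hn' α)⟩
  · push Not at hex
    exact ⟨0, fun n _ j => hex n j⟩

theorem converge [Fintype Q] [Fintype Q'] (H : FinApx N N' F) :
    ∃ CB : ℕ, ∀ (c : Q × ℕ) (c' : Q' × ℕ),
      Simulates N.Step N'.Step c c' ↔ ∀ α, F CB α c c' := by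
  classical
  choose K hK using fun x : Q × Q' => H.exists_level x.1 x.2
  set M := Finset.univ.sup K with hM
  refine ⟨M + 1, fun c c' => ⟨?_, ?_⟩⟩
  · rintro ⟨R, hR, hc⟩ α
    exact H.of_sim R hR α _ _ _ hc
  · intro h
    refine ⟨fun c c' => ∀ α, F (M + 1) α c c', ?_, h⟩
    rintro ⟨p, m⟩ ⟨p', m'⟩ h a ⟨q, n⟩ hst
    obtain ⟨q', r, ⟨g1, _, g3⟩ | ⟨d, g1, g2, g3⟩⟩ := H.unfold M p m p' m' h a q n hst
    · have hle : K (q, q') ≤ M := Finset.le_sup (Finset.mem_univ _)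
      obtain ⟨s, hs⟩ := hK (q, q') n ⟨r, fun α => H.anti_nat α hle _ _ (g3 α)⟩ (M + 1)
      exact ⟨(q', max s (m' + 1)), Or.inr ⟨g1, by simp only; omega⟩,
        fun α => H.mono α _ _ _ _ _ _ _ le_rfl (le_max_left _ _) (hs α)⟩
    · exact ⟨(q', r), Or.inl ⟨d, g1, g2⟩, g3⟩

end FinApx

/-- For strong simulation `⪯` between a one-counter net `N`
and an ω-net `N'`, there exists a constant `CB ∈ ℕ` such that
`⪯ = ⪯^CB = ⋂_α ⪯^CB_α`: the approximants `⪯^β` converge to the simulation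
preorder at some finite level `CB`. -/
theorem finite_convergence {Q Q' A : Type}
    [Fintype Q] [Fintype Q'] [Fintype A]
    (N : OCN Q A) (N' : OmegaNet Q' A)
    (Apx : Ordinal → Ordinal → (Q × ℕ) → (Q' × ℕ) → Prop)
    (hApx : IsApxFamily N N' Apx) :
    ∃ CB : ℕ, ∀ (c : Q × ℕ) (c' : Q' × ℕ),
      Simulates N.Step N'.Step c c' ↔ ∀ α : Ordinal, Apx (CB : Ordinal) α c c' := by
  obtain ⟨h0, hz, hs, _, hl⟩ := hApx
  have H : FinApx N N' (fun k α => Apx (k : Ordinal) α) :=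
    { h0 := fun α c c' => by simpa using h0 α c c'
      hz := fun k c c' => hz _ c c'
      hs := fun k α p m p' m' => by
        simpa only [Nat.cast_add, Nat.cast_one] using hs (k : Ordinal) α p m p' m'
      hl := fun k α hα c c' => hl _ α hα c c' }
  exact H.converge
end

section
/- For the approximant relations between a one-counter net and an ω-net, it holds that ⪯_{ω·i} ⊆ ⪯^i for every i ∈ ℕ, where ⪯_α are the ordinary strong simulation approximants and ⪯^i = ⋂_{α ∈ Ord} ⪯^i_α. -/
/-- The ordinary strong simulation approximants `⪯_α`, defined by transfinite
recursion: `⪯_0` is the full relation, `s ⪯_{α+1} s'` iff every step of `s`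
has a response with results related by `⪯_α`, and at limits `⪯_λ` is the
intersection of the earlier approximants.  (The uniform recursion below —
`s ⪯_α s'` iff for all `α' < α` every step of `s` has a response with results
in `⪯_{α'}` — satisfies exactly these defining equations.) -/
noncomputable def SimApx {S S' A : Type} (stepL : S → A → S → Prop)
    (stepR : S' → A → S' → Prop) : Ordinal → S → S' → Prop :=
  WellFounded.fix Ordinal.lt_wf (C := fun _ => S → S' → Prop)
    (fun α ih c c' =>
      ∀ (α' : Ordinal) (h : α' < α), ∀ a d, stepL c a d →
        ∃ d', stepR c' a d' ∧ ih α' h d d')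

theorem SimApx_iff {S S' A : Type} (stepL : S → A → S → Prop)
    (stepR : S' → A → S' → Prop) (α : Ordinal) (c : S) (c' : S') :
    SimApx stepL stepR α c c' ↔ ∀ α' < α, ∀ a d, stepL c a d →
      ∃ d', stepR c' a d' ∧ SimApx stepL stepR α' d d' := by
  unfold SimApx
  rw [WellFounded.fix_eq]

theorem SimApx_anti {S S' A : Type} (stepL : S → A → S → Prop)
    (stepR : S' → A → S' → Prop) {α γ : Ordinal} (h : α ≤ γ) {c : S} {c' : S'}
    (H : SimApx stepL stepR γ c c') : SimApx stepL stepR α c c' := by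
  rw [SimApx_iff] at H ⊢
  exact fun α' h' => H α' (h'.trans_le h)

theorem lt_omega_block {i : ℕ} {α : Ordinal}
    (h : α < Ordinal.omega0 * ((i + 1 : ℕ) : Ordinal)) :
    ∃ n : ℕ, α < Ordinal.omega0 * (i : Ordinal) + n := by
  rw [Nat.cast_succ, mul_add, mul_one] at h
  obtain ⟨x, hx, hx'⟩ := (Ordinal.lt_add_iff Ordinal.omega0_ne_zero).1 h
  obtain ⟨n, rfl⟩ := Ordinal.lt_omega0.1 hx
  refine ⟨n + 1, hx'.trans_lt ?_⟩
  push_cast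
  rw [← add_assoc]
  exact Order.lt_add_one_iff.2 le_rfl

theorem SimApx_block.{u} {S S' A : Type} (stepL : S → A → S → Prop)
    (stepR : S' → A → S' → Prop) {i : ℕ} {c : S} {c' : S'}
    (H : ∀ n : ℕ, SimApx stepL stepR (Ordinal.omega0.{u} * (i : Ordinal.{u}) + n) c c') :
    SimApx stepL stepR (Ordinal.omega0.{u} * ((i + 1 : ℕ) : Ordinal)) c c' := by
  rw [SimApx_iff]
  intro α' h
  obtain ⟨n, hn⟩ := lt_omega_block h
  exact (SimApx_iff ..).1 (H n) α' hn

/-- For the approximant relations between a one-counter net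
and an ω-net, `⪯_{ω·i} ⊆ ⪯^i` for every `i ∈ ℕ`, where `⪯_α` are the
ordinary strong simulation approximants and `⪯^i = ⋂_α ⪯^i_α`. -/
theorem alpha_beta_connection {Q Q' A : Type}
    [Fintype Q] [Fintype Q'] [Fintype A]
    (N : OCN Q A) (N' : OmegaNet Q' A)
    (Apx : Ordinal → Ordinal → (Q × ℕ) → (Q' × ℕ) → Prop)
    (hApx : IsApxFamily N N' Apx) (i : ℕ) :
    ∀ (c : Q × ℕ) (c' : Q' × ℕ),
      SimApx N.Step N'.Step (Ordinal.omega0 * (i : Ordinal)) c c' →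
      ∀ α : Ordinal, Apx (i : Ordinal) α c c' := by
  obtain ⟨h0, h0', hs, -, hl⟩ := hApx
  induction i with
  | zero => intro c c' _ α; simpa using h0 α c c'
  | succ i ih =>
    intro c c' H α
    induction α using Ordinal.limitRecOn generalizing c c' with
    | zero => exact h0' _ _ _
    | limit α hα IH => exact (hl _ _ hα _ _).2 fun α' h' => IH α' h' c c' H
    | add_one α IH =>
      obtain ⟨p, m⟩ := c
      obtain ⟨p', m'⟩ := c'
      rw [Nat.cast_succ, hs]
      intro a q n hstep
      have hresp : ∀ k : ℕ, ∃ d', N'.Step (p', m') a d' ∧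
          SimApx N.Step N'.Step (Ordinal.omega0 * (i : Ordinal) + k) (q, n) d' := by
        intro k
        refine (SimApx_iff ..).1 H _ ?_ a (q, n) hstep
        rw [Nat.cast_succ, mul_add, mul_one]
        exact (add_lt_add_iff_left _).2 (Ordinal.natCast_lt_omega0 k)
      by_contra hcon
      push Not at hcon
      -- no ordinary response survives all levels of the block
      have hbad : ∀ x : Q' × Fin (m' + 2), ∃ k : ℕ,
          (∃ d : ℤ, N'.δ p' a (some d) x.1 ∧ ((x.2 : ℕ) : ℤ) = (m' : ℤ) + d) →
          ¬ SimApx N.Step N'.Step (Ordinal.omega0 * (i : Ordinal) + k) (q, n)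
            (x.1, (x.2 : ℕ)) := by
        rintro ⟨q', x⟩
        by_contra hx
        push Not at hx
        obtain ⟨d, hd, hd'⟩ := (hx 0).1
        refine (hcon q' x).2 d hd hd' ?_
        rw [← Nat.cast_succ]
        exact IH _ _ (SimApx_block _ _ fun k => (hx k).2)
      choose f hf using hbad
      obtain ⟨⟨q', n'⟩, hst, hsim⟩ := hresp (Finset.univ.sup f)
      rcases hst with ⟨d, hd, hd'⟩ | ⟨hd, hlt⟩
      · have hb := N'.effect_bounded _ _ _ _ hd
        simp only at hd'
        have hn' : n' < m' + 2 := by omega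
        refine hf (q', ⟨n', hn'⟩) ⟨d, hd, hd'⟩ (SimApx_anti _ _ ?_ hsim)
        have : f (q', ⟨n', hn'⟩) ≤ Finset.univ.sup f := Finset.le_sup (Finset.mem_univ _)
        gcongr
      · exact (hcon q' n').1 hd hlt (ih _ _ (SimApx_anti _ _ le_self_add hsim) α)
end

section
/- For any one-counter net M with control-state set Q and ω-net M' with control-state set Q', and every k ∈ ℕ, there exists a pair of one-counter nets S_k, S_k' with control-state sets containing Q and Q' respectively, such that for all m,m' ∈ ℕ and all states p ∈ Q, p' ∈ Q': pm ⪯^k p'm' with respect to M, M' if and only if pm ⪯ p'm' with respect to S_k, S_k'. -/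
section Helpers
universe u v

/-- Spoiler's net: actions reveal the target state, and there is a decrementing test action. -/
def spoilerNet {Q A : Type} (M : OCN Q A) : OCN Q (Option (A × Q)) where
  δ p b d q := (∃ a, b = some (a, q) ∧ M.δ p a d q) ∨ (b = none ∧ d = -1 ∧ q = p)
  effect_bounded := by
    rintro p b d q (⟨a, _, h⟩ | ⟨_, h, _⟩)
    · exact M.effect_bounded _ _ _ _ h
    · exact Or.inl h

/-- Duplicator's net: `inr none` is universal, `inr (some j)` survives exactly `j` test actions. -/
def duplicatorNet {Q Q' A : Type} (M' : OmegaNet Q' A) (D : Q → Q' → ℕ → Prop) (C : ℕ) :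
    OCN (Q' ⊕ Option (Fin C)) (Option (A × Q)) where
  δ x b d y :=
    (∃ p' a q q', x = Sum.inl p' ∧ b = some (a, q) ∧ y = Sum.inl q' ∧ M'.δ p' a (some d) q') ∨
    (∃ p' a q q', x = Sum.inl p' ∧ b = some (a, q) ∧ y = Sum.inr none ∧ d = 0 ∧
      M'.δ p' a none q' ∧ ∀ n, D q q' n) ∨
    (∃ p' a q q' j, x = Sum.inl p' ∧ b = some (a, q) ∧ y = Sum.inr (some j) ∧ d = 0 ∧
      M'.δ p' a none q' ∧ D q q' j.1) ∨
    (∃ p', x = Sum.inl p' ∧ b = none ∧ y = Sum.inr none ∧ d = 0) ∨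
    (x = Sum.inr none ∧ y = Sum.inr none ∧ d = 0) ∨
    (∃ j c, x = Sum.inr (some j) ∧ b = some c ∧ y = Sum.inr none ∧ d = 0) ∨
    (∃ j i, x = Sum.inr (some j) ∧ b = none ∧ y = Sum.inr (some i) ∧ j.1 = i.1 + 1 ∧ d = 0)
  effect_bounded := by
    rintro x b d y (⟨p', a, q, q', _, _, _, h⟩ | ⟨_, _, _, _, _, _, _, h, _⟩ |
      ⟨_, _, _, _, _, _, _, _, h, _⟩ | ⟨_, _, _, _, h⟩ | ⟨_, _, h⟩ | ⟨_, _, _, _, _, h⟩ |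
      ⟨_, _, _, _, _, _, h⟩)
    · exact M'.effect_bounded _ _ _ _ h
    all_goals exact Or.inr (Or.inl h)

variable {Q Q' A : Type} {M : OCN Q A} {M' : OmegaNet Q' A}
  {Apx : Ordinal.{u} → Ordinal.{v} → (Q × ℕ) → (Q' × ℕ) → Prop}

theorem apx_succ_iff (hApx : IsApxFamily M M' Apx) (k : ℕ) (α : Ordinal.{v})
    (p : Q) (m : ℕ) (p' : Q') (m' : ℕ) :
    Apx ((k + 1 : ℕ) : Ordinal) (α + 1) (p, m) (p', m') ↔
      ∀ a (q : Q) (n : ℕ), M.Step (p, m) a (q, n) →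
        ∃ (q' : Q') (n' : ℕ),
          (M'.δ p' a none q' ∧ m' < n' ∧ Apx (k : ℕ) α (q, n) (q', n')) ∨
          (∃ d : ℤ, M'.δ p' a (some d) q' ∧ (n' : ℤ) = (m' : ℤ) + d ∧
            Apx ((k + 1 : ℕ) : Ordinal) α (q, n) (q', n')) := by
  have := hApx.2.2.1 (k : Ordinal) α p m p' m'
  rw [Nat.cast_succ]
  exact this

theorem apx_zero (hApx : IsApxFamily M M' Apx) (α : Ordinal.{v}) (c c') :
    Apx ((0 : ℕ) : Ordinal) α c c' := by
  rw [Nat.cast_zero]; exact hApx.1 α c c'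

theorem apx_mono (hApx : IsApxFamily M M' Apx) (α : Ordinal.{v}) :
    ∀ (k : ℕ) (p : Q) (m : ℕ) (p' : Q') (m' : ℕ) (m₁ m₁' : ℕ), m₁ ≤ m → m' ≤ m₁' →
      Apx (k : Ordinal) α (p, m) (p', m') → Apx (k : Ordinal) α (p, m₁) (p', m₁') := by
  induction α using Ordinal.limitRecOn with
  | zero => intros; exact hApx.2.1 _ _ _
  | limit α hα ih =>
    intro k p m p' m' m₁ m₁' h1 h2 h
    rw [hApx.2.2.2.2 _ _ hα] at h ⊢
    exact fun β hβ => ih β hβ k p m p' m' m₁ m₁' h1 h2 (h β hβ)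
  | add_one α ih =>
    intro k p m p' m' m₁ m₁' h1 h2 h
    cases k with
    | zero => exact apx_zero hApx _ _ _
    | succ k =>
      rw [apx_succ_iff hApx] at h ⊢
      rintro a q n ⟨d, hd, hn⟩
      dsimp only at hd hn
      obtain ⟨q', n', h | ⟨e, he, hn', h⟩⟩ := h a q (n + (m - m₁)) ⟨d, hd, by dsimp only; omega⟩
      · exact ⟨q', n' + (m₁' - m'), Or.inl ⟨h.1, by omega,
          ih _ _ _ _ _ _ _ (by omega) (by omega) h.2.2⟩⟩
      · exact ⟨q', n' + (m₁' - m'), Or.inr ⟨e, he, by omega,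
          ih _ _ _ _ _ _ _ (by omega) (by omega) h⟩⟩

theorem apx_antitone (hApx : IsApxFamily M M' Apx) (α' : Ordinal.{v}) :
    ∀ (α : Ordinal.{v}), α' ≤ α → ∀ (k : ℕ) (p : Q) (m : ℕ) (p' : Q') (m' : ℕ),
      Apx (k : Ordinal) α (p, m) (p', m') → Apx (k : Ordinal) α' (p, m) (p', m') := by
  induction α' using Ordinal.limitRecOn with
  | zero => intros; exact hApx.2.1 _ _ _
  | limit α' hα ih =>
    intro α hle k p m p' m' h
    rw [hApx.2.2.2.2 _ _ hα]
    exact fun β hβ => ih β hβ α (hβ.le.trans hle) k p m p' m' h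
  | add_one γ ih =>
    intro α hle k p m p' m' h
    rcases Ordinal.zero_or_succ_or_isSuccLimit α with h0 | ⟨δ, hδ⟩ | hlim
    · subst h0
      exact absurd (lt_of_lt_of_le (Order.lt_add_one_iff.2 le_rfl) hle) (by simp)
    · subst hδ
      cases k with
      | zero => exact apx_zero hApx _ _ _
      | succ k =>
        have hle' : γ ≤ δ := by simpa using hle
        have h' : Apx ((k + 1 : ℕ) : Ordinal) (δ + 1) (p, m) (p', m') := h
        rw [apx_succ_iff hApx] at h' ⊢
        intro a q n hs
        obtain ⟨q', n', h | ⟨e, he, hn', h⟩⟩ := h' a q n hs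
        · exact ⟨q', n', Or.inl ⟨h.1, h.2.1, ih _ hle' _ _ _ _ _ h.2.2⟩⟩
        · exact ⟨q', n', Or.inr ⟨e, he, hn', ih _ hle' _ _ _ _ _ h⟩⟩
    · rcases hle.lt_or_eq with hlt | heq
      · exact (hApx.2.2.2.2 _ _ hlim _ _).1 h _ hlt
      · rw [heq]; exact h

/-- The limit relation satisfies the fixpoint equation. -/
theorem apx_inf_step (hApx : IsApxFamily M M' Apx) (k : ℕ) (p : Q) (m : ℕ) (p' : Q') (m' : ℕ)
    (h : ∀ α, Apx ((k + 1 : ℕ) : Ordinal) α (p, m) (p', m'))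
    (a : A) (q : Q) (n : ℕ) (hs : M.Step (p, m) a (q, n)) :
    ∃ (q' : Q') (n' : ℕ),
      (M'.δ p' a none q' ∧ m' < n' ∧ ∀ α, Apx (k : ℕ) α (q, n) (q', n')) ∨
      (∃ d : ℤ, M'.δ p' a (some d) q' ∧ (n' : ℤ) = (m' : ℤ) + d ∧
        ∀ α, Apx ((k + 1 : ℕ) : Ordinal) α (q, n) (q', n')) := by
  have key : ∀ j : ℕ, ∃ γ : Ordinal.{v}, ∀ q' n', Apx (j : ℕ) γ (q, n) (q', n') →
      ∀ α, Apx (j : ℕ) α (q, n) (q', n') := by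
    intro j
    have : ∀ c : Q' × ℕ, ∃ γ : Ordinal.{v}, Apx (j : ℕ) γ (q, n) c →
        ∀ α, Apx (j : ℕ) α (q, n) c := by
      intro c
      by_cases hc : ∀ α, Apx (j : ℕ) α (q, n) c
      · exact ⟨0, fun _ => hc⟩
      · push Not at hc
        obtain ⟨γ, hγ⟩ := hc
        exact ⟨γ, fun h => absurd h hγ⟩
    choose f hf using this
    obtain ⟨γ, hγ⟩ := Ordinal.bddAbove_of_small (s := Set.range f)
    exact ⟨γ, fun q' n' h => hf (q', n')
      (apx_antitone hApx _ _ (hγ ⟨_, rfl⟩) _ _ _ _ _ h)⟩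
  obtain ⟨γ₁, h₁⟩ := key k
  obtain ⟨γ₂, h₂⟩ := key (k + 1)
  obtain ⟨q', n', hh | ⟨e, he, hn', hh⟩⟩ :=
    (apx_succ_iff hApx k (max γ₁ γ₂) p m p' m').1 (h _) a q n hs
  · exact ⟨q', n', Or.inl ⟨hh.1, hh.2.1,
      h₁ _ _ (apx_antitone hApx _ _ (le_max_left _ _) _ _ _ _ _ hh.2.2)⟩⟩
  · exact ⟨q', n', Or.inr ⟨e, he, hn',
      h₂ _ _ (apx_antitone hApx _ _ (le_max_right _ _) _ _ _ _ _ hh)⟩⟩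

/-- In any simulation, `inr (some j)` can only be related to counter values at most `j`. -/
theorem sim_le {D : Q → Q' → ℕ → Prop} {C : ℕ} {R : Q × ℕ → (Q' ⊕ Option (Fin C)) × ℕ → Prop}
    (hR : IsSimulation (spoilerNet M).Step (duplicatorNet M' D C).Step R) :
    ∀ (n : ℕ) (j : Fin C) (q : Q) (m : ℕ), R (q, n) (Sum.inr (some j), m) → n ≤ j.1 := by
  intro n
  induction n with
  | zero => intros; omega
  | succ n ih =>
    intro j q m h
    obtain ⟨⟨y, l⟩, ⟨d, hd, hl⟩, hy⟩ := hR _ _ h none (q, n)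
      ⟨-1, Or.inr ⟨rfl, rfl, rfl⟩, by push_cast; ring⟩
    simp only [duplicatorNet] at hd
    simp at hd
    obtain ⟨i, hi, hij, _⟩ := hd
    subst hi
    have := ih _ _ _ hy
    omega

end Helpers

/-- For any one-counter net `M` (states `Q`), ω-net `M'`
(states `Q'`) and every `k ∈ ℕ`, there is a pair of one-counter nets
`S_k, S_k'` whose control-state sets contain `Q` and `Q'` respectively, such
that for all `m, m' ∈ ℕ`, `p ∈ Q` and `p' ∈ Q'`:
`pm ⪯^k p'm'` w.r.t. `M, M'` (where `⪯^k = ⋂_α ⪯^k_α`) iff `pm ⪯ p'm'`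
w.r.t. `S_k, S_k'`. -/
theorem approximant_characterization_by_nets {Q Q' A : Type}
    [Fintype Q] [Fintype Q'] [Fintype A]
    (M : OCN Q A) (M' : OmegaNet Q' A)
    (Apx : Ordinal → Ordinal → (Q × ℕ) → (Q' × ℕ) → Prop)
    (hApx : IsApxFamily M M' Apx) (k : ℕ) :
    ∃ (B : Type) (_ : Fintype B) (SQ SQ' : Type) (_ : Fintype SQ) (_ : Fintype SQ')
      (ι : Q → SQ) (ι' : Q' → SQ')
      (Sk : OCN SQ B) (Sk' : OCN SQ' B),
      Function.Injective ι ∧ Function.Injective ι' ∧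
      ∀ (p : Q) (p' : Q') (m m' : ℕ),
        (∀ α : Ordinal, Apx (k : Ordinal) α (p, m) (p', m')) ↔
        Simulates Sk.Step Sk'.Step (ι p, m) (ι' p', m') := by
  classical
  cases k with
  | zero =>
    refine ⟨Unit, inferInstance, Q, Q', inferInstance, inferInstance, id, id,
      ⟨fun _ _ _ _ => False, fun _ _ _ _ h => h.elim⟩,
      ⟨fun _ _ _ _ => False, fun _ _ _ _ h => h.elim⟩,
      Function.injective_id, Function.injective_id, ?_⟩
    intro p p' m m'
    refine ⟨fun _ => ⟨fun _ _ => True, ?_, trivial⟩, fun _ α => apx_zero hApx _ _ _⟩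
    rintro c c' - a d ⟨_, h, _⟩
    exact h.elim
  | succ k =>
    let D : Q → Q' → ℕ → Prop := fun q q' n => ∃ n', ∀ α, Apx (k : Ordinal) α (q, n) (q', n')
    have hD : ∀ q q' n n₁, n₁ ≤ n → D q q' n → D q q' n₁ := by
      rintro q q' n n₁ hle ⟨n', h⟩
      exact ⟨n', fun α => apx_mono hApx α _ _ _ _ _ _ _ hle le_rfl (h α)⟩
    obtain ⟨C, hC⟩ : ∃ C : ℕ, ∀ q q', (∀ n, D q q' n) ∨ ∀ n, D q q' n → n < C := by
      have : ∀ x : Q × Q', ∃ c : ℕ, (∀ n, D x.1 x.2 n) ∨ ∀ n, D x.1 x.2 n → n < c := by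
        intro x
        by_cases hx : ∀ n, D x.1 x.2 n
        · exact ⟨0, Or.inl hx⟩
        · push Not at hx
          obtain ⟨c, hc⟩ := hx
          refine ⟨c, Or.inr fun n hn => ?_⟩
          by_contra hlt
          exact hc (hD _ _ _ _ (not_lt.1 hlt) hn)
      choose f hf using this
      refine ⟨Finset.univ.sup f, fun q q' => (hf (q, q')).imp id fun h n hn => ?_⟩
      exact (h n hn).trans_le (Finset.le_sup (f := f) (Finset.mem_univ (q, q')))
    refine ⟨Option (A × Q), inferInstance, Q, Q' ⊕ Option (Fin C), inferInstance, inferInstance,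
      id, Sum.inl, spoilerNet M, duplicatorNet M' D C,
      Function.injective_id, Sum.inl_injective, ?_⟩
    intro p p' m m'
    constructor
    · intro h
      refine ⟨fun c c' => match c' with
        | (Sum.inl x, l) => ∀ α, Apx ((k + 1 : ℕ) : Ordinal) α c (x, l)
        | (Sum.inr none, _) => True
        | (Sum.inr (some j), _) => c.2 ≤ j.1, ?_, h⟩
      rintro ⟨p, m⟩ ⟨x | (_ | j), l⟩ hr b ⟨q, n⟩ ⟨d, hd, hn⟩
      · dsimp only at hr hd hn
        rcases hd with ⟨a, rfl, hd⟩ | ⟨rfl, rfl, rfl⟩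
        · obtain ⟨q', n', ⟨h1, h2, h3⟩ | ⟨e, he, hn', h3⟩⟩ :=
            apx_inf_step hApx k p m x l hr a q n ⟨d, hd, hn⟩
          · rcases hC q q' with hall | hlt
            · exact ⟨(Sum.inr none, l), ⟨0, Or.inr (Or.inl
                ⟨x, a, q, q', rfl, rfl, rfl, rfl, h1, hall⟩), by simp⟩, trivial⟩
            · have hDn : D q q' n := ⟨n', h3⟩
              exact ⟨(Sum.inr (some ⟨n, hlt n hDn⟩), l), ⟨0, Or.inr (Or.inr (Or.inl
                ⟨x, a, q, q', _, rfl, rfl, rfl, rfl, h1, hDn⟩)), by simp⟩, le_refl n⟩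
          · exact ⟨(Sum.inl q', n'), ⟨e, Or.inl
              ⟨x, a, q, q', rfl, rfl, rfl, he⟩, hn'⟩, h3⟩
        · exact ⟨(Sum.inr none, l), ⟨0, Or.inr (Or.inr (Or.inr (Or.inl
            ⟨x, rfl, rfl, rfl, rfl⟩))), by simp⟩, trivial⟩
      · exact ⟨(Sum.inr none, l), ⟨0, Or.inr (Or.inr (Or.inr (Or.inr (Or.inl
            ⟨rfl, rfl, rfl⟩)))), by simp⟩, trivial⟩
      · dsimp only at hr hd hn
        rcases hd with ⟨a, rfl, hd⟩ | ⟨rfl, rfl, rfl⟩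
        · exact ⟨(Sum.inr none, l), ⟨0, Or.inr (Or.inr (Or.inr (Or.inr (Or.inr (Or.inl
            ⟨j, _, rfl, rfl, rfl, rfl⟩))))), by simp⟩, trivial⟩
        · have hj := j.2
          refine ⟨(Sum.inr (some ⟨j.1 - 1, by omega⟩), l), ⟨0,
            Or.inr (Or.inr (Or.inr (Or.inr (Or.inr (Or.inr
            ⟨j, _, rfl, rfl, rfl, ?_, rfl⟩))))), by simp⟩, ?_⟩
          · dsimp only; omega
          · dsimp only; omega
    · rintro ⟨R, hR, hr⟩ α
      induction α using Ordinal.limitRecOn generalizing p p' m m' with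
      | zero => exact hApx.2.1 _ _ _
      | limit α hα ih =>
        rw [hApx.2.2.2.2 _ _ hα]
        exact fun β hβ => ih β hβ p p' m m' hr
      | add_one α ih =>
        rw [apx_succ_iff hApx]
        rintro a q n ⟨d, hd, hn⟩
        obtain ⟨⟨y, l⟩, ⟨e, he, hl⟩, hy⟩ := hR _ _ hr (some (a, q)) (q, n)
          ⟨d, Or.inl ⟨a, rfl, hd⟩, hn⟩
        have fin : ∀ q', M'.δ p' a none q' → D q q' n → ∃ (q' : Q') (n' : ℕ),
          (M'.δ p' a none q' ∧ m' < n' ∧ Apx (k : ℕ) α (q, n) (q', n')) ∨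
          (∃ d : ℤ, M'.δ p' a (some d) q' ∧ (n' : ℤ) = (m' : ℤ) + d ∧
            Apx ((k + 1 : ℕ) : Ordinal) α (q, n) (q', n')) := by
          rintro q' h1 ⟨n', h2⟩
          exact ⟨q', n' + m' + 1, Or.inl ⟨h1, by omega,
            apx_mono hApx α _ _ _ _ _ _ _ le_rfl (by omega) (h2 α)⟩⟩
        dsimp only at hl
        simp only [duplicatorNet] at he
        simp at he
        rcases he with ⟨q', rfl, he⟩ | ⟨rfl, rfl, q', h1, h2⟩ | ⟨q', j, rfl, rfl, h1, h2⟩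
        · exact ⟨q', l, Or.inr ⟨e, he, hl, ih _ _ _ _ hy⟩⟩
        · exact fin q' h1 (h2 n)
        · exact fin q' h1 (hD _ _ _ _ (sim_le hR _ _ _ _ hy) h2)
end
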